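/- arXiv:1602.06449 — 5 statements merged into one kernel-verified Lean document; each statement's English description precedes it below -/
import Mathlib

section
/- Multiplicativity of the sign under stacking: for planar tree diagrams P ∈ 𝒜(n;r), Q ∈ 𝒜(m;s) and any k ∈ {1,…,n}, sign(P ≺_k Q) = sign(P) · sign(Q). -/
open scoped BigOperators

/-!  Combinatorial framework for Gauss diagrams of (string) links and for the
Kravchenko–Polyak tree diagrams/tree invariants (following the paper
"Tree invariants and Milnor linking numbers with indeterminacy").

Strings of a diagram on `n` strings are indexed by `1, …, n`; each string is
oriented downward from a basepoint at its top, and the position of an endpoint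
on its string is a rational number which increases from top to bottom. -/

/-- A Gauss diagram on `n` strings: a finite type of signed arrows, each with a
head endpoint and a tail endpoint lying on strings `1,…,n`, all endpoints
distinct, the endpoints on each string being linearly ordered (top-to-bottom)
by their position. An endpoint is encoded as a pair `(g, b)` where `b = true`
designates the head of the arrow `g` and `b = false` its tail. -/
structure GaussDiagram (n : ℕ) where
  Arrow : Type
  fin : Fintype Arrow
  dec : DecidableEq Arrow
  /-- the string carrying the head of an arrow -/
  hs : Arrow → ℕ
  /-- the string carrying the tail of an arrow -/
  ts : Arrow → ℕ
  /-- the position of the head on its string (positions increase downward) -/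
  hp : Arrow → ℚ
  /-- the position of the tail on its string -/
  tp : Arrow → ℚ
  /-- the sign `ε(g) ∈ {+1, -1}` of an arrow -/
  sign : Arrow → ℤ
  hs_mem : ∀ g, hs g ∈ Finset.Icc 1 n
  ts_mem : ∀ g, ts g ∈ Finset.Icc 1 n
  sign_unit : ∀ g, sign g = 1 ∨ sign g = -1
  /-- all endpoints are distinct -/
  distinct : ∀ e e' : Arrow × Bool,
    (if e.2 then hs e.1 else ts e.1) = (if e'.2 then hs e'.1 else ts e'.1) →
    (if e.2 then hp e.1 else tp e.1) = (if e'.2 then hp e'.1 else tp e'.1) →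
    e = e'

attribute [instance] GaussDiagram.fin GaussDiagram.dec

namespace GaussDiagram

variable {n : ℕ}

/-- the string on which an endpoint lies -/
def estr (G : GaussDiagram n) (e : G.Arrow × Bool) : ℕ :=
  if e.2 then G.hs e.1 else G.ts e.1

/-- the position of an endpoint on its string -/
def epos (G : GaussDiagram n) (e : G.Arrow × Bool) : ℚ :=
  if e.2 then G.hp e.1 else G.tp e.1

end GaussDiagram

/-- The data of a tree diagram.  By axiom (d2), a tree diagram with leaves
indexed by `I` and trunk `j` has exactly one arrow tailed at each string
`i ∈ I \ {j}`, so its arrows are canonically indexed by `I.erase j`: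
`par i` is the string carrying the head of the arrow tailed at string `i`
(the "parent" string), and `rk i` is the rank (counted from the top, starting
at `0`) of the head of this arrow among all the arrowheads lying on the string
`par i`.  By axiom (d4) the tail on a string lies below all the heads on that
string, so `par` and `rk` determine the diagram up to isomorphism.  Junk
values are pinned by `par i = i` and `rk i = 0` outside `I.erase j`. -/
structure PreTree where
  par : ℕ → ℕ
  rk : ℕ → ℕ

namespace PreTree

/-- `A` is a tree diagram with leaves indexed by `I` and trunk `j`:
axioms (d1)–(d4), together with canonicality of the ranks and the pinning of
junk values. -/
def IsTreeDiagram (I : Finset ℕ) (j : ℕ) (A : PreTree) : Prop :=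
  (∀ i ∈ I.erase j, A.par i ∈ I ∧ A.par i ≠ i ∧
      A.rk i < (((I.erase j).filter fun b => A.par b = A.par i)).card) ∧
  (∀ i ∈ I.erase j, ∀ i' ∈ I.erase j,
      A.par i = A.par i' → A.rk i = A.rk i' → i = i') ∧
  (∀ i, i ∉ I.erase j → A.par i = i ∧ A.rk i = 0)

/-- `A` is planar: the associated rooted tree admits a planar embedding in
which the strings appear in increasing left-to-right order.  Concretely, the
arrows can be drawn as horizontal segments at pairwise distinct heights
`h i` (heights increase downward), compatibly with the order of the endpoints
on each string, in such a way that no arrow crosses the retained part of an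
intermediate string (in particular no arrow passes over the trunk). -/
def IsPlanar (I : Finset ℕ) (j : ℕ) (A : PreTree) : Prop :=
  ∃ h : ℕ → ℚ,
    (∀ i ∈ I.erase j, ∀ i' ∈ I.erase j, h i = h i' → i = i') ∧
    (∀ i ∈ I.erase j, ∀ i' ∈ I.erase j, A.par i = A.par i' →
        (A.rk i < A.rk i' ↔ h i < h i')) ∧
    (∀ i ∈ I.erase j, ∀ i' ∈ I.erase j, A.par i = i' → h i < h i') ∧
    (∀ a ∈ I.erase j, ∀ k ∈ I, min (A.par a) a < k → k < max (A.par a) a →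
        k ≠ j ∧ h k < h a)

end PreTree

/-- `𝒜(I;j)`: the set of planar tree diagrams with leaves indexed by `I` and
trunk `j`. -/
def TreeSet (I : Finset ℕ) (j : ℕ) : Set PreTree :=
  {A | A.IsTreeDiagram I j ∧ A.IsPlanar I j}

/-- `𝒜(n;r) = 𝒜({1,…,n};r)`. -/
def TreeSetFull (n r : ℕ) : Set PreTree :=
  TreeSet (Finset.Icc 1 n) r

/-- `sign(A) = (-1)^q` where `q` is the number of arrows of `A` pointing to
the right, i.e. whose head lies on a higher-indexed string than the tail. -/
def treeSign (I : Finset ℕ) (j : ℕ) (A : PreTree) : ℤ :=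
  (-1) ^ (((I.erase j).filter fun i => i < A.par i)).card

/-- A representation `φ` of the tree diagram `A` (with leaves `I`, trunk `j`)
in the Gauss diagram `G`: an injective map from the arrows of `A` (indexed by
their tail strings) to the arrows of `G`, preserving head strings, tail
strings, and the top-to-bottom order of the endpoints on each string. -/
def IsRep {n : ℕ} (G : GaussDiagram n) (I : Finset ℕ) (j : ℕ) (A : PreTree)
    (φ : {x // x ∈ I.erase j} → G.Arrow) : Prop :=
  Function.Injective φ ∧
  (∀ a, G.hs (φ a) = A.par a.1) ∧
  (∀ a, G.ts (φ a) = a.1) ∧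
  (∀ a a', A.par a.1 = A.par a'.1 →
      (A.rk a.1 < A.rk a'.1 ↔ G.hp (φ a) < G.hp (φ a'))) ∧
  (∀ a a', A.par a.1 = a'.1 → G.hp (φ a) < G.tp (φ a'))

/-- `sign(φ) = ∏_{α ∈ A} ε(φ(α))`. -/
noncomputable def repSign {n : ℕ} (G : GaussDiagram n) {s : Finset ℕ}
    (φ : {x // x ∈ s} → G.Arrow) : ℤ :=
  ∏ᶠ a, G.sign (φ a)

/-- `⟨A,G⟩ = ∑_φ sign(φ)`, the sum over all representations of `A` in `G`. -/
noncomputable def pair {n : ℕ} (G : GaussDiagram n) (I : Finset ℕ) (j : ℕ)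
    (A : PreTree) : ℤ :=
  ∑ᶠ (φ : {x // x ∈ I.erase j} → G.Arrow) (_ : IsRep G I j A φ), repSign G φ

/-- `⟨A,G⟩_{α ↦ g}`: the part of `⟨A,G⟩` coming from representations sending
the arrow `α` of `A` tailed at the string `a` to the arrow `g` of `G`. -/
noncomputable def pairTo {n : ℕ} (G : GaussDiagram n) (I : Finset ℕ) (j : ℕ)
    (A : PreTree) (a : {x // x ∈ I.erase j}) (g : G.Arrow) : ℤ :=
  ∑ᶠ (φ : {x // x ∈ I.erase j} → G.Arrow) (_ : IsRep G I j A φ ∧ φ a = g),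
    repSign G φ

/-- `⟨A,G⟩_{α ↛ g}`: the part of `⟨A,G⟩` coming from representations not
sending the arrow `α` of `A` tailed at the string `a` to the arrow `g`. -/
noncomputable def pairNotTo {n : ℕ} (G : GaussDiagram n) (I : Finset ℕ) (j : ℕ)
    (A : PreTree) (a : {x // x ∈ I.erase j}) (g : G.Arrow) : ℤ :=
  ∑ᶠ (φ : {x // x ∈ I.erase j} → G.Arrow) (_ : IsRep G I j A φ ∧ φ a ≠ g),
    repSign G φ

/-- The tree pairing `⟨Z_{I;j},G⟩ = ∑_{A ∈ 𝒜(I;j)} sign(A)⟨A,G⟩`. -/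
noncomputable def Zpair {n : ℕ} (G : GaussDiagram n) (I : Finset ℕ) (j : ℕ) : ℤ :=
  ∑ᶠ (A : PreTree) (_ : A ∈ TreeSet I j), treeSign I j A * pair G I j A

/-- `Δ_Z(I;·) = gcd{⟨Z_{J;k},G⟩ : J ⊊ I, k ∈ J}`. -/
noncomputable def DeltaZ {n : ℕ} (G : GaussDiagram n) (I : Finset ℕ) : ℤ :=
  (((I.powerset.erase I).sigma fun J => J)).gcd fun p => Zpair G p.1 p.2
/-! ### Moves on Gauss diagrams -/

/-- The endpoints `e₁` and `e₂` (lying on a common string) are consecutive on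
their string: no other endpoint lies strictly between them. -/
def Consecutive {n : ℕ} (G : GaussDiagram n) (e₁ e₂ : G.Arrow × Bool) : Prop :=
  ∀ e : G.Arrow × Bool, e ≠ e₁ → e ≠ e₂ → G.estr e = G.estr e₁ →
    ¬ (min (G.epos e₁) (G.epos e₂) < G.epos e ∧
        G.epos e < max (G.epos e₁) (G.epos e₂))

/-- `ψ` matches arrows of `G` with arrows of `G'` preserving signs, head
strings and tail strings. -/
def ArrowMap {n : ℕ} (G G' : GaussDiagram n) (ψ : G.Arrow → G'.Arrow) : Prop :=
  (∀ g, G'.sign (ψ g) = G.sign g) ∧ (∀ g, G'.hs (ψ g) = G.hs g) ∧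
  (∀ g, G'.ts (ψ g) = G.ts g)

/-- `ψ` preserves the relative (top-to-bottom) order of all pairs of endpoints
lying on a common string, except possibly for pairs meeting the set `S`. -/
def OrderPresOn {n : ℕ} (G G' : GaussDiagram n) (ψ : G.Arrow → G'.Arrow)
    (S : Set (G.Arrow × Bool)) : Prop :=
  ∀ e e' : G.Arrow × Bool, e ∉ S → e' ∉ S → G.estr e = G.estr e' →
    (G.epos e < G.epos e' ↔ G'.epos (ψ e.1, e.2) < G'.epos (ψ e'.1, e'.2))

/-- Basepoint move: on one string, the topmost endpoint becomes the bottommost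
endpoint of that string (or vice versa); all other data are unchanged. -/
def BasepointMove {n : ℕ} (G G' : GaussDiagram n) : Prop :=
  ∃ ψ : G.Arrow ≃ G'.Arrow, ArrowMap G G' ψ ∧
    ∃ e₀ : G.Arrow × Bool,
      OrderPresOn G G' ψ {e₀} ∧
      ((∀ e, e ≠ e₀ → G.estr e = G.estr e₀ →
          G.epos e₀ < G.epos e ∧ G'.epos (ψ e.1, e.2) < G'.epos (ψ e₀.1, e₀.2)) ∨
       (∀ e, e ≠ e₀ → G.estr e = G.estr e₀ →
          G.epos e < G.epos e₀ ∧ G'.epos (ψ e₀.1, e₀.2) < G'.epos (ψ e.1, e.2)))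

/-- Insertion of an isolated arrow `g₀` whose head and tail are consecutive
endpoints on a single string (first Reidemeister move). -/
def R1Ins {n : ℕ} (G G' : GaussDiagram n) : Prop :=
  ∃ (ψ : G.Arrow → G'.Arrow) (g₀ : G'.Arrow),
    Function.Injective ψ ∧ ArrowMap G G' ψ ∧ OrderPresOn G G' ψ ∅ ∧
    (∀ g, ψ g ≠ g₀) ∧ (∀ h, h ≠ g₀ → ∃ g, ψ g = h) ∧
    G'.hs g₀ = G'.ts g₀ ∧ Consecutive G' (g₀, true) (g₀, false)

/-- First Reidemeister move (insertion or deletion). -/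
def R1Move {n : ℕ} (G G' : GaussDiagram n) : Prop :=
  R1Ins G G' ∨ R1Ins G' G

/-- Insertion of a parallel pair `g₊, g₋` of arrows of opposite signs, with
heads consecutive on a common string and tails consecutive on a common string,
in parallel position (second Reidemeister move). -/
def R2Ins {n : ℕ} (G G' : GaussDiagram n) : Prop :=
  ∃ (ψ : G.Arrow → G'.Arrow) (gp gm : G'.Arrow),
    Function.Injective ψ ∧ ArrowMap G G' ψ ∧ OrderPresOn G G' ψ ∅ ∧
    gp ≠ gm ∧ (∀ g, ψ g ≠ gp ∧ ψ g ≠ gm) ∧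
    (∀ h, h ≠ gp → h ≠ gm → ∃ g, ψ g = h) ∧
    G'.sign gp = - G'.sign gm ∧ G'.hs gp = G'.hs gm ∧ G'.ts gp = G'.ts gm ∧
    Consecutive G' (gp, true) (gm, true) ∧
    Consecutive G' (gp, false) (gm, false) ∧
    (G'.hp gp < G'.hp gm ↔ G'.tp gp < G'.tp gm)

/-- Second Reidemeister move (insertion or deletion). -/
def R2Move {n : ℕ} (G G' : GaussDiagram n) : Prop :=
  R2Ins G G' ∨ R2Ins G' G

/-- Third Reidemeister move: the three designated pairs of consecutive
endpoints of the positive arrows `g ∼ (i₁,i₂)`, `h ∼ (i₁,i₃)`, `k ∼ (i₂,i₃)`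
have their relative order reversed, all other relative orders of endpoints
being preserved. -/
def R3Move {n : ℕ} (G G' : GaussDiagram n) : Prop :=
  ∃ (ψ : G.Arrow ≃ G'.Arrow) (g h k : G.Arrow),
    ArrowMap G G' ψ ∧
    g ≠ h ∧ g ≠ k ∧ h ≠ k ∧
    G.sign g = 1 ∧ G.sign h = 1 ∧ G.sign k = 1 ∧
    G.hs h = G.hs g ∧ G.hs k = G.ts g ∧ G.ts k = G.ts h ∧
    Consecutive G (g, true) (h, true) ∧
    Consecutive G (g, false) (k, true) ∧
    Consecutive G (h, false) (k, false) ∧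
    (G.epos (g, true) < G.epos (h, true) ↔
      G'.epos (ψ h, true) < G'.epos (ψ g, true)) ∧
    (G.epos (g, false) < G.epos (k, true) ↔
      G'.epos (ψ k, true) < G'.epos (ψ g, false)) ∧
    (G.epos (h, false) < G.epos (k, false) ↔
      G'.epos (ψ k, false) < G'.epos (ψ h, false)) ∧
    (∀ e e' : G.Arrow × Bool, G.estr e = G.estr e' →
      ¬ (({e, e'} : Set (G.Arrow × Bool)) = {(g, true), (h, true)} ∨
         ({e, e'} : Set (G.Arrow × Bool)) = {(g, false), (k, true)} ∨
         ({e, e'} : Set (G.Arrow × Bool)) = {(h, false), (k, false)}) →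
      (G.epos e < G.epos e' ↔ G'.epos (ψ e.1, e.2) < G'.epos (ψ e'.1, e'.2)))

/-- `G` and `G'` have identical sets of arrows with head and tail on distinct
strings (same signs, same head/tail strings, same relative order of the
endpoints of these arrows on each string); they may differ arbitrarily in
arrows whose head and tail lie on the same string.  This is the equivalence
generated by the self-arrow moves (insertion, deletion, sign change of an
arrow with both endpoints on one string). -/
def MixedEquiv {n : ℕ} (G G' : GaussDiagram n) : Prop :=
  ∃ ψ : {g : G.Arrow // G.hs g ≠ G.ts g} ≃ {g : G'.Arrow // G'.hs g ≠ G'.ts g},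
    (∀ g, G'.sign (ψ g).1 = G.sign g.1) ∧
    (∀ g, G'.hs (ψ g).1 = G.hs g.1) ∧
    (∀ g, G'.ts (ψ g).1 = G.ts g.1) ∧
    (∀ (g g' : {g : G.Arrow // G.hs g ≠ G.ts g}) (b b' : Bool),
      G.estr (g.1, b) = G.estr (g'.1, b') →
      (G.epos (g.1, b) < G.epos (g'.1, b') ↔
        G'.epos ((ψ g).1, b) < G'.epos ((ψ g').1, b')))

/-- A single arrow `g` of `G` is replaced by the arrow `g' = ψ g` of `G'` with
the same sign, head string and tail string, in a possibly different position;
all other arrows and all relative orders of their endpoints are unchanged. -/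
def MovedArrow {n : ℕ} (G G' : GaussDiagram n) (g : G.Arrow) (g' : G'.Arrow) :
    Prop :=
  ∃ ψ : G.Arrow ≃ G'.Arrow, ψ g = g' ∧ ArrowMap G G' ψ ∧
    ∀ e e' : G.Arrow × Bool, e.1 ≠ g → e'.1 ≠ g → G.estr e = G.estr e' →
      (G.epos e < G.epos e' ↔ G'.epos (ψ e.1, e.2) < G'.epos (ψ e'.1, e'.2))
/-! ### Stacking of planar tree diagrams -/

/-- Relabelling of the strings of `P` (a planar tree diagram on the strings
`1,…,n` with trunk `r`) when a diagram on `m` strings with trunk `s` is stacked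
onto its `k`-th leaf: strings left of `k` keep their index, the `k`-th string
is glued onto the trunk of the stacked diagram (index `k+s-1`), and strings
right of `k` are shifted by `m-1`. -/
def embP (k m s p : ℕ) : ℕ :=
  if p < k then p else if p = k then k + s - 1 else p + m - 1

/-- The inverse relabelling: the string of `P` from which the string `i` of
`P ≺ₖ Q` originates. -/
def invP (k m s i : ℕ) : ℕ :=
  if i < k then i else if i = k + s - 1 then k else i - (m - 1)

/-- The number of arrowheads lying on the trunk string of the tree diagram `Q`
on `m` strings with trunk `s`. -/
def qcount (m s : ℕ) (Q : PreTree) : ℕ :=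
  ((((Finset.Icc 1 m).erase s)).filter fun q => Q.par q = s).card

/-- The stacking `P ≺ₖ Q` of the tree diagram `Q` (on `m` strings, trunk `s`)
onto the `k`-th leaf of the tree diagram `P`: the trunk string of `Q` is glued
onto the `k`-th leaf string of `P` (the arrows of `Q` lying above those of `P`
on the glued string) and the resulting strings are renumbered `1,…,n+m-1` in
left-to-right planar order, the strings of `Q` occupying positions
`k,…,k+m-1`. -/
def stack (k m s : ℕ) (P Q : PreTree) : PreTree where
  par i :=
    if k ≤ i ∧ i ≤ k + m - 1 ∧ i ≠ k + s - 1 then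
      k + Q.par (i - k + 1) - 1
    else
      embP k m s (P.par (invP k m s i))
  rk i :=
    if k ≤ i ∧ i ≤ k + m - 1 ∧ i ≠ k + s - 1 then
      Q.rk (i - k + 1)
    else if P.par (invP k m s i) = k ∧ invP k m s i ≠ k then
      P.rk (invP k m s i) + qcount m s Q
    else
      P.rk (invP k m s i)

/-- The trunk of `P ≺ₖ Q` (where `P` has trunk `r` and `Q` has `m` strings and
trunk `s`). -/
def stackTrunk (r k m s : ℕ) : ℕ :=
  if r < k then r else if k < r then r + m - 1 else k + s - 1

/-- The elementary tree `e ∈ 𝒜(2;1)`: one arrow with head on string `1` (the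
trunk) and tail on string `2`. -/
def etree : PreTree :=
  ⟨fun i => if i = 2 then 1 else i, fun _ => 0⟩

/-- The elementary tree `ē ∈ 𝒜(2;2)`: one arrow with head on string `2` (the
trunk) and tail on string `1`. -/
def ebar : PreTree :=
  ⟨fun i => if i = 1 then 2 else i, fun _ => 0⟩

/-- The `k`-th smallest element of the finite set `I` (`1`-indexed). -/
def enumIn (I : Finset ℕ) (k : ℕ) : ℕ :=
  (I.sort (· ≤ ·)).getD (k - 1) 0

/-- The (`1`-indexed) rank of `x` in the finite set `I`. -/
def rankIn (I : Finset ℕ) (x : ℕ) : ℕ :=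
  ((I.filter fun y => y ≤ x)).card

/-- Relabel a tree diagram on the strings `1,…,|I|` so that its strings are
indexed by the elements of `I` (in increasing order); this realizes a tree
diagram `A' ∈ 𝒜(I;·)` from `A ∈ 𝒜(|I|;·)` as in the pairing `⟨A, G(I)⟩`. -/
def relabel (I : Finset ℕ) (P : PreTree) : PreTree where
  par x := if x ∈ I then enumIn I (P.par (rankIn I x)) else x
  rk x := if x ∈ I then P.rk (rankIn I x) else 0
theorem embP_strictMono {k m s : ℕ} (hs : 1 ≤ s ∧ s ≤ m) : StrictMono (embP k m s) := by
  intro p q hpq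
  simp only [embP]
  split_ifs <;> omega

theorem invP_embP {k m s : ℕ} (hs : 1 ≤ s ∧ s ≤ m) (p : ℕ) :
    invP k m s (embP k m s p) = p := by
  simp only [embP, invP]
  split_ifs <;> omega

theorem embP_invP {k m s i : ℕ} (hs : 1 ≤ s ∧ s ≤ m)
    (hi : ¬(k ≤ i ∧ i ≤ k + m - 1 ∧ i ≠ k + s - 1)) :
    embP k m s (invP k m s i) = i := by
  simp only [embP, invP]
  split_ifs <;> omega

theorem stackTrunk_eq_embP (r k m s : ℕ) : stackTrunk r k m s = embP k m s r := by
  simp only [stackTrunk, embP]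
  split_ifs <;> omega

/-- No string of `P` is relabelled to a string of `Q` other than the trunk of `Q`. -/
theorem embP_notMem_block {k m s : ℕ} (hs : 1 ≤ s ∧ s ≤ m) (p : ℕ) :
    ¬(k ≤ embP k m s p ∧ embP k m s p ≤ k + m - 1 ∧ embP k m s p ≠ k + s - 1) := by
  simp only [embP]
  split_ifs <;> omega

theorem embP_mem_Icc_iff {n k m s : ℕ} (hs : 1 ≤ s ∧ s ≤ m) (hk : 1 ≤ k ∧ k ≤ n) (p : ℕ) :
    embP k m s p ∈ Finset.Icc 1 (m + n - 1) ↔ p ∈ Finset.Icc 1 n := by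
  simp only [embP, Finset.mem_Icc]
  split_ifs <;> omega

theorem stack_par_embP {k m s : ℕ} (hs : 1 ≤ s ∧ s ≤ m) (P Q : PreTree) (p : ℕ) :
    (stack k m s P Q).par (embP k m s p) = embP k m s (P.par p) := by
  simp only [stack, if_neg (embP_notMem_block hs p), invP_embP hs]

theorem stack_par_block {k m s q : ℕ} (hk : 1 ≤ k) (hq : q ∈ (Finset.Icc 1 m).erase s)
    (P Q : PreTree) :
    (stack k m s P Q).par (k + q - 1) = k + Q.par q - 1 := by
  simp only [Finset.mem_erase, Finset.mem_Icc] at hq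
  have h : k ≤ k + q - 1 ∧ k + q - 1 ≤ k + m - 1 ∧ k + q - 1 ≠ k + s - 1 := by omega
  have hsub : k + q - 1 - k + 1 = q := by omega
  simp only [stack, if_pos h, hsub]

/-- The right-pointing arrows of `P ≺ₖ Q` are those of `P` together with those of `Q`. -/
theorem filter_lt_stack_par {n m r s k : ℕ} (P Q : PreTree)
    (hs : 1 ≤ s ∧ s ≤ m) (hk : 1 ≤ k ∧ k ≤ n) :
    ((Finset.Icc 1 (m + n - 1)).erase (stackTrunk r k m s)).filter
        (fun i => i < (stack k m s P Q).par i) =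
      (((Finset.Icc 1 n).erase r).filter fun p => p < P.par p).image (embP k m s) ∪
        (((Finset.Icc 1 m).erase s).filter fun q => q < Q.par q).image (fun q => k + q - 1) := by
  have hmono := embP_strictMono (k := k) hs
  ext i
  rw [stackTrunk_eq_embP]
  simp only [Finset.mem_union, Finset.mem_image, Finset.mem_filter]
  constructor
  · rintro ⟨hi, hlt⟩
    by_cases hb : k ≤ i ∧ i ≤ k + m - 1 ∧ i ≠ k + s - 1
    · right
      obtain ⟨q, rfl⟩ : ∃ q, i = k + q - 1 := ⟨i - k + 1, by omega⟩
      have hq : q + (k - 1) - (k - 1) ∈ (Finset.Icc 1 m).erase s := by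
        simp only [Finset.mem_erase, Finset.mem_Icc] at hi ⊢
        omega
      rw [Nat.add_sub_cancel] at hq
      rw [stack_par_block hk.1 hq] at hlt
      exact ⟨q, ⟨hq, by omega⟩, rfl⟩
    · left
      have hinv := embP_invP hs hb
      rw [← hinv] at hi hlt
      rw [stack_par_embP hs, hmono.lt_iff_lt] at hlt
      rw [Finset.mem_erase, hmono.injective.ne_iff, embP_mem_Icc_iff hs hk] at hi
      exact ⟨_, ⟨Finset.mem_erase.2 hi, hlt⟩, hinv⟩
  · rintro (⟨p, ⟨hp, hlt⟩, rfl⟩ | ⟨q, ⟨hq, hlt⟩, rfl⟩)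
    · rw [stack_par_embP hs, hmono.lt_iff_lt, Finset.mem_erase, hmono.injective.ne_iff,
        embP_mem_Icc_iff hs hk]
      exact ⟨Finset.mem_erase.1 hp, hlt⟩
    · rw [stack_par_block hk.1 hq]
      simp only [Finset.mem_erase, Finset.mem_Icc] at hq ⊢
      refine ⟨⟨fun h => embP_notMem_block (k := k) hs r ?_, by omega⟩, by omega⟩
      rw [← h]
      omega

/-- **Multiplicativity of the sign under stacking.**  For planar tree diagrams
`P ∈ 𝒜(n;r)`, `Q ∈ 𝒜(m;s)` and any `k ∈ {1,…,n}`,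
`sign(P ≺ₖ Q) = sign(P) · sign(Q)`. -/
theorem stack_sign (n m r s k : ℕ) (P Q : PreTree)
    (hP : P ∈ TreeSetFull n r) (hQ : Q ∈ TreeSetFull m s)
    (hr : 1 ≤ r ∧ r ≤ n) (hs : 1 ≤ s ∧ s ≤ m) (hk : 1 ≤ k ∧ k ≤ n) :
    treeSign (Finset.Icc 1 (m + n - 1)) (stackTrunk r k m s) (stack k m s P Q) =
      treeSign (Finset.Icc 1 n) r P * treeSign (Finset.Icc 1 m) s Q := by
  unfold treeSign
  rw [filter_lt_stack_par P Q hs hk, Finset.card_union_of_disjoint,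
    Finset.card_image_of_injective _ (embP_strictMono hs).injective,
    Finset.card_image_of_injOn, pow_add]
  · intro a _ b _ hab
    simp only at hab
    omega
  · rw [Finset.disjoint_left]
    simp only [Finset.mem_image, Finset.mem_filter, Finset.mem_erase, Finset.mem_Icc]
    rintro _ ⟨p, -, rfl⟩ ⟨q, hq, hqp⟩
    refine embP_notMem_block (k := k) hs p ?_
    rw [← hqp]
    omega
end

section
/- Localization of the pairing difference at a moved arrow: let G and G' be Gauss diagrams on n strings with the same set of arrows except that one arrow g ∼ (i,j) of G is replaced by an arrow g' ∼ (i,j) of G' of the same sign in a possibly different position, i.e. there is a bijection between the arrows of G and of G' matching g with g' and preserving signs, head/tail string indices, and the relative top-to-bottom order of all endpoints other than those of g and g'. If a tree diagram A ∈ 𝒜(n;t) contains an arrow α with head on string i and tail on string j (such an arrow is unique by axiom (d2)), then ⟨A,G⟩_{α↛g} = ⟨A,G'⟩_{α↛g'}, and consequently ⟨A,G⟩ − ⟨A,G'⟩ = ⟨A,G⟩_{α↦g} − ⟨A,G'⟩_{α↦g'}. -/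
open scoped BigOperators

/-- A pairing splits according to whether the arrow tailed at `a` is sent to `g`. -/
lemma pair_eq_pairTo_add_pairNotTo {n : ℕ} (G : GaussDiagram n) (I : Finset ℕ) (j : ℕ)
    (A : PreTree) (a : {x // x ∈ I.erase j}) (g : G.Arrow) :
    pair G I j A = pairTo G I j A a g + pairNotTo G I j A a g := by
  unfold pair pairTo pairNotTo
  rw [← finsum_add_distrib (Set.toFinite _) (Set.toFinite _)]
  refine finsum_congr fun φ => ?_
  by_cases hφ : IsRep G I j A φ <;> by_cases ha : φ a = g <;> simp [hφ, ha]

lemma ArrowMap.repSign_comp {n : ℕ} {G G' : GaussDiagram n} {ψ : G.Arrow → G'.Arrow}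
    (h : ArrowMap G G' ψ) {s : Finset ℕ} (φ : {x // x ∈ s} → G.Arrow) :
    repSign G' (ψ ∘ φ) = repSign G φ :=
  finprod_congr fun a => h.1 (φ a)

/-- A matching of arrows that preserves the order of all endpoints not belonging to `g`
preserves and reflects representations avoiding `g`. -/
lemma ArrowMap.isRep_comp_iff {n : ℕ} {G G' : GaussDiagram n} {ψ : G.Arrow → G'.Arrow}
    (h : ArrowMap G G' ψ) (hψ : Function.Injective ψ) {g : G.Arrow}
    (hord : ∀ e e' : G.Arrow × Bool, e.1 ≠ g → e'.1 ≠ g → G.estr e = G.estr e' →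
      (G.epos e < G.epos e' ↔ G'.epos (ψ e.1, e.2) < G'.epos (ψ e'.1, e'.2)))
    {I : Finset ℕ} {j : ℕ} {A : PreTree} {φ : {x // x ∈ I.erase j} → G.Arrow}
    (hφ : (∀ b, G.ts (φ b) = b.1) → ∀ b, φ b ≠ g) :
    IsRep G' I j A (ψ ∘ φ) ↔ IsRep G I j A φ := by
  simp only [IsRep, hψ.of_comp_iff, Function.comp_apply, h.2.1, h.2.2]
  refine and_congr_right fun _ => and_congr_right fun hhs => and_congr_right fun hts => ?_
  have hg := hφ hts
  refine and_congr (forall₃_congr fun b b' hb => ?_) (forall₃_congr fun b b' hb => ?_)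
  · have := hord (φ b, true) (φ b', true) (hg b) (hg b')
      (by simp [GaussDiagram.estr, hhs, hb])
    simp only [GaussDiagram.epos, if_true] at this
    rw [this]
  · have := hord (φ b, true) (φ b', false) (hg b) (hg b')
      (by simp [GaussDiagram.estr, hhs, hts, hb])
    simpa [GaussDiagram.epos] using this.symm

/-- Moving an arrow `g` does not affect the contribution of the representations that do not
use `g` for the arrow tailed at the string of its tail. -/
lemma MovedArrow.pairNotTo_eq {n : ℕ} {G G' : GaussDiagram n} {g : G.Arrow} {g' : G'.Arrow}
    (hmv : MovedArrow G G' g g') {I : Finset ℕ} {j : ℕ} (A : PreTree)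
    (a : {x // x ∈ I.erase j}) (htail : (a : ℕ) = G.ts g) :
    pairNotTo G I j A a g = pairNotTo G' I j A a g' := by
  obtain ⟨ψ, rfl, hmap, hord⟩ := hmv
  unfold pairNotTo
  rw [← finsum_comp_equiv (Equiv.arrowCongr (Equiv.refl {x // x ∈ I.erase j}) ψ)]
  refine finsum_congr fun φ => ?_
  have hcomp : Equiv.arrowCongr (Equiv.refl _) ψ φ = ψ ∘ φ := rfl
  rw [hcomp, hmap.repSign_comp]
  refine finsum_congr_Prop (propext ?_) fun _ => rfl
  rw [Function.comp_apply, ψ.injective.ne_iff]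
  refine and_congr_left fun ha => (hmap.isRep_comp_iff ψ.injective hord fun hts b hb => ha ?_).symm
  have hba : b = a := Subtype.ext (by rw [htail, ← hb, hts])
  rw [← hba, hb]

/-- **Localization of the pairing difference at a moved arrow.**  Let `G` and
`G'` have the same arrows except that the arrow `g ∼ (i,j)` of `G` is replaced
by the arrow `g' ∼ (i,j)` of `G'` of the same sign in a possibly different
position.  If the tree diagram `A ∈ 𝒜(n;t)` contains an arrow `α` with head on
the string `i` and tail on the string `j` (i.e. the arrow tailed at
`a = j = ts g`, with `par a = i = hs g`), then
`⟨A,G⟩_{α↛g} = ⟨A,G'⟩_{α↛g'}`, and consequently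
`⟨A,G⟩ − ⟨A,G'⟩ = ⟨A,G⟩_{α↦g} − ⟨A,G'⟩_{α↦g'}`. -/
theorem moved_arrow_localization (n : ℕ) (G G' : GaussDiagram n)
    (g : G.Arrow) (g' : G'.Arrow) (hmv : MovedArrow G G' g g')
    (t : ℕ) (A : PreTree) (hA : A ∈ TreeSet (Finset.Icc 1 n) t)
    (a : {x // x ∈ (Finset.Icc 1 n).erase t})
    (htail : (a : ℕ) = G.ts g) (hhead : A.par a.1 = G.hs g) :
    pairNotTo G (Finset.Icc 1 n) t A a g =
      pairNotTo G' (Finset.Icc 1 n) t A a g' ∧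
    pair G (Finset.Icc 1 n) t A - pair G' (Finset.Icc 1 n) t A =
      pairTo G (Finset.Icc 1 n) t A a g -
        pairTo G' (Finset.Icc 1 n) t A a g' := by
  have h := hmv.pairNotTo_eq A a htail
  refine ⟨h, ?_⟩
  rw [pair_eq_pairTo_add_pairNotTo G _ t A a g, pair_eq_pairTo_add_pairNotTo G' _ t A a g', h]
  ring
end

section
/- Free-factor factorization of the restricted pairing (top-arrow case): let G be a Gauss diagram on n strings and let g ∼ (i,j), i < j, be an arrow of G whose head is the topmost endpoint on string i of G. Let A ∈ 𝒜(n;t) contain an arrow α ∼ (i,j) and admit the decomposition A = P ≺_i Q with Q = e ≺₂ R, where the elementary tree e corresponds to α and P ≠ ∅ (so the head of α is the topmost arrowhead on string i of A). Set I = I(P;A) and J = I(Q;A), so that I ∩ J = {i}. Then ⟨A,G⟩_{α↦g} = ⟨P,G(I)⟩ · ⟨Q,G(J)⟩_{α↦g}, where G(I) denotes the subdiagram of G consisting of the strings indexed by I together with all arrows having both endpoints on those strings. -/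
open scoped BigOperators

/-! ### Relabelling along an increasing enumeration -/

theorem List.getD_length_filter_le_of_mem {l : List ℕ} (hl : l.Pairwise (· < ·)) {x : ℕ}
    (hx : x ∈ l) : l.getD ((l.filter (· ≤ x)).length - 1) 0 = x := by
  induction l with
  | nil => simp at hx
  | cons a l ih =>
    rw [List.pairwise_cons] at hl
    rcases List.mem_cons.1 hx with rfl | hx'
    · have : l.filter (· ≤ x) = [] := by
        simpa [List.filter_eq_nil_iff] using fun b hb => hl.1 b hb
      simp [this]
    · have hax : a ≤ x := (hl.1 x hx').le
      have hpos : 0 < (l.filter (· ≤ x)).length :=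
        List.length_pos_of_mem (List.mem_filter.2 ⟨hx', by simp⟩)
      have := ih hl.2 hx'
      obtain ⟨k, hk⟩ := Nat.exists_eq_succ_of_ne_zero hpos.ne'
      rw [hk] at this
      simpa [List.filter_cons, hax, hk] using this

theorem enumIn_rankIn {I : Finset ℕ} {x : ℕ} (hx : x ∈ I) : enumIn I (rankIn I x) = x := by
  have hcard : rankIn I x = ((I.sort (· ≤ ·)).filter (· ≤ x)).length := by
    rw [← List.toFinset_card_of_nodup ((Finset.sort_nodup I _).filter _), List.toFinset_filter,
      Finset.sort_toFinset]
    simp [rankIn]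
  rw [enumIn, hcard]
  exact List.getD_length_filter_le_of_mem (Finset.sortedLT_sort I).pairwise
    ((Finset.mem_sort _).2 hx)

theorem rankIn_Icc {a b x : ℕ} (hx : x ≤ b) : rankIn (Finset.Icc a b) x = x + 1 - a := by
  have : (Finset.Icc a b).filter (· ≤ x) = Finset.Icc a x := by
    ext y; simp only [Finset.mem_filter, Finset.mem_Icc]; omega
  simp [rankIn, this]

theorem enumIn_Icc {a b k : ℕ} (hk : 1 ≤ k) (hkb : a + k ≤ b + 1) :
    enumIn (Finset.Icc a b) k = a + k - 1 := by
  have h := enumIn_rankIn (I := Finset.Icc a b) (x := a + k - 1)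
    (by simp only [Finset.mem_Icc]; omega)
  rwa [rankIn_Icc (by omega), show a + k - 1 + 1 - a = k by omega] at h

/-- The strings of `P` in a stacking on the `i`-th leaf of a diagram with `r + 1` strings whose
trunk is leftmost. -/
theorem rankIn_union_Icc {i r n x : ℕ} (hx : x ∈ Finset.Icc 1 i ∪ Finset.Icc (i + r + 1) n) :
    rankIn (Finset.Icc 1 i ∪ Finset.Icc (i + r + 1) n) x = invP i (r + 1) 1 x := by
  simp only [Finset.mem_union, Finset.mem_Icc] at hx
  have hrank : rankIn (Finset.Icc 1 i ∪ Finset.Icc (i + r + 1) n) x =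
      min x i + (x - (i + r)) := by
    have : (Finset.Icc 1 i ∪ Finset.Icc (i + r + 1) n).filter (· ≤ x) =
        Finset.Icc 1 (min x i) ∪ Finset.Icc (i + r + 1) x := by
      ext y; simp only [Finset.mem_filter, Finset.mem_union, Finset.mem_Icc]; omega
    rw [rankIn, this, Finset.card_union_of_disjoint]
    · simp only [Nat.card_Icc]; omega
    · rw [Finset.disjoint_left]; intro y; simp only [Finset.mem_Icc]; omega
  rw [hrank, invP]; split_ifs <;> omega

theorem enumIn_union_Icc {i r n p k : ℕ} (hn : n = p + r) (hk : k ∈ Finset.Icc 1 p) :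
    enumIn (Finset.Icc 1 i ∪ Finset.Icc (i + r + 1) n) k = embP i (r + 1) 1 k := by
  rw [Finset.mem_Icc] at hk
  have hmem : embP i (r + 1) 1 k ∈ Finset.Icc 1 i ∪ Finset.Icc (i + r + 1) n := by
    simp only [embP, Finset.mem_union, Finset.mem_Icc]; split_ifs <;> omega
  have h := enumIn_rankIn hmem
  have hinv : invP i (r + 1) 1 (embP i (r + 1) 1 k) = k := by
    simp only [invP, embP]; split_ifs <;> omega
  rwa [rankIn_union_Icc hmem, hinv] at h

/-! ### Tree diagrams and stackings -/

namespace PreTree.IsTreeDiagram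

variable {I : Finset ℕ} {j x : ℕ} {A : PreTree}

theorem par_mem (h : A.IsTreeDiagram I j) (hx : x ∈ I) : A.par x ∈ I := by
  by_cases hxj : x ∈ I.erase j
  · exact (h.1 x hxj).1
  · rwa [(h.2.2 x hxj).1]

theorem par_trunk (h : A.IsTreeDiagram I j) : A.par j = j :=
  (h.2.2 j (Finset.notMem_erase j I)).1

theorem eq_trunk_of_par_eq (h : A.IsTreeDiagram I j) (hx : x ∈ I) (hpar : A.par x = x) :
    x = j := by
  by_contra hne
  exact (h.1 x (Finset.mem_erase.2 ⟨hne, hx⟩)).2.1 hpar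

end PreTree.IsTreeDiagram

section Stack

variable {i m s y : ℕ} {P Q R : PreTree}

theorem stack_one_par_add (hy : 1 ≤ y) (hym : y ≤ m) :
    (stack i (m + 1) 1 P Q).par (i + y) = i + Q.par (y + 1) - 1 := by
  simp only [stack]
  rw [if_pos (by omega), show i + y - i + 1 = y + 1 by omega]

theorem stack_one_rk_add (hy : 1 ≤ y) (hym : y ≤ m) :
    (stack i (m + 1) 1 P Q).rk (i + y) = Q.rk (y + 1) := by
  simp only [stack]
  rw [if_pos (by omega), show i + y - i + 1 = y + 1 by omega]

theorem stack_one_par_of_outer (h : y ≤ i ∨ i + m + 1 ≤ y) :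
    (stack i (m + 1) 1 P Q).par y = embP i (m + 1) 1 (P.par (invP i (m + 1) 1 y)) := by
  simp only [stack]
  rw [if_neg (by omega)]

theorem stack_one_rk_of_outer (h : y ≤ i ∨ i + m + 1 ≤ y) :
    (stack i (m + 1) 1 P Q).rk y =
      if P.par (invP i (m + 1) 1 y) = i ∧ invP i (m + 1) 1 y ≠ i then
        P.rk (invP i (m + 1) 1 y) + qcount (m + 1) 1 Q
      else P.rk (invP i (m + 1) 1 y) := by
  simp only [stack]
  rw [if_neg (by omega)]

theorem stack_etree_par_trunk (hs : 1 ≤ s) :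
    (stack 2 m s etree R).par (s + 1) = 1 := by
  have : invP 2 m s (s + 1) = 2 := by simp only [invP]; split_ifs <;> omega
  simp only [stack]
  rw [if_neg (by omega), this]
  simp [etree, embP]

theorem stack_etree_par_succ (hy : 1 ≤ y) (hym : y ≤ m) (hys : y ≠ s) :
    (stack 2 m s etree R).par (y + 1) = R.par y + 1 := by
  simp only [stack]
  rw [if_pos (by omega), show y + 1 - 2 + 1 = y by omega]
  omega

theorem stack_etree_rk_trunk (hs : 1 ≤ s) :
    (stack 2 m s etree R).rk (s + 1) = 0 := by
  have : invP 2 m s (s + 1) = 2 := by simp only [invP]; split_ifs <;> omega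
  simp only [stack]
  rw [if_neg (by omega), this]
  simp [etree]

theorem stack_etree_par_mem (hs : 1 ≤ s) (hR : R.IsTreeDiagram (Finset.Icc 1 m) s)
    (hy : 1 ≤ y) (hym : y ≤ m) :
    (stack 2 m s etree R).par (y + 1) ∈ Finset.Icc 1 (m + 1) := by
  by_cases hys : y = s
  · rw [hys, stack_etree_par_trunk hs]; simp
  · have := Finset.mem_Icc.1 (hR.par_mem (Finset.mem_Icc.2 ⟨hy, hym⟩))
    rw [stack_etree_par_succ hy hym hys, Finset.mem_Icc]; omega

theorem eq_of_stack_etree_par_eq_one (hR : R.IsTreeDiagram (Finset.Icc 1 m) s)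
    (hy : 1 ≤ y) (hym : y ≤ m) (h : (stack 2 m s etree R).par (y + 1) = 1) : y = s := by
  by_contra hys
  have := Finset.mem_Icc.1 (hR.par_mem (Finset.mem_Icc.2 ⟨hy, hym⟩))
  rw [stack_etree_par_succ hy hym hys] at h; omega

theorem qcount_stack_etree_pos (hs : 1 ≤ s) (hsm : s ≤ m) :
    0 < qcount (m + 1) 1 (stack 2 m s etree R) := by
  refine Finset.card_pos.2 ⟨s + 1, ?_⟩
  simp only [Finset.mem_filter, Finset.mem_erase, Finset.mem_Icc]
  exact ⟨by omega, stack_etree_par_trunk hs⟩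

end Stack

/-! ### Gluing representations along a common string -/

/-- `A` is obtained from `P` (leaves `I`, trunk `t`) and `Q` (leaves `J`, trunk `i`) by gluing
along their only common string `i`, on which `Q` has a single arrowhead, that of the arrow tailed
at `c`, which lies above all arrowheads of `P`. -/
structure IsTopGluing (S I J : Finset ℕ) (t i c : ℕ) (A P Q : PreTree) : Prop where
  mem_erase_iff : ∀ x, x ∈ S.erase t ↔ x ∈ I.erase t ∨ x ∈ J.erase i
  eq_of_mem : ∀ x ∈ I, x ∈ J → x = i
  par_left_mem : ∀ a ∈ I.erase t, P.par a ∈ I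
  par_right_mem : ∀ b ∈ J.erase i, Q.par b ∈ J
  par_left : ∀ a ∈ I.erase t, A.par a = P.par a
  par_right : ∀ b ∈ J.erase i, A.par b = Q.par b
  rk_left : ∀ a ∈ I.erase t, ∀ a' ∈ I.erase t, P.par a = P.par a' →
    (A.rk a < A.rk a' ↔ P.rk a < P.rk a')
  rk_right : ∀ b ∈ J.erase i, A.rk b = Q.rk b
  eq_root : ∀ b ∈ J.erase i, Q.par b = i → b = c
  root_lt : ∀ a ∈ I.erase t, P.par a = i → A.rk c < A.rk a

namespace IsTopGluing

variable {S I J : Finset ℕ} {t i c n : ℕ} {A P Q : PreTree}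

theorem disjoint (h : IsTopGluing S I J t i c A P Q) : Disjoint (I.erase t) (J.erase i) := by
  rw [Finset.disjoint_left]
  intro x hx hx'
  exact (Finset.mem_erase.1 hx').1
    (h.eq_of_mem x (Finset.mem_of_mem_erase hx) (Finset.mem_of_mem_erase hx'))

/-- The arrows of the glued diagram are those of its two factors. -/
def arrowEquiv (h : IsTopGluing S I J t i c A P Q) :
    {x // x ∈ I.erase t} ⊕ {x // x ∈ J.erase i} ≃ {x // x ∈ S.erase t} :=
  (Equiv.Finset.union _ _ h.disjoint).trans
    (Equiv.subtypeEquivRight fun x => by rw [h.mem_erase_iff, Finset.mem_union])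

@[simp] theorem arrowEquiv_inl (h : IsTopGluing S I J t i c A P Q) (a : {x // x ∈ I.erase t}) :
    (h.arrowEquiv (Sum.inl a)).1 = a.1 := rfl

@[simp] theorem arrowEquiv_inr (h : IsTopGluing S I J t i c A P Q) (b : {x // x ∈ J.erase i}) :
    (h.arrowEquiv (Sum.inr b)).1 = b.1 := rfl

theorem isRep_iff (h : IsTopGluing S I J t i c A P Q) (G : GaussDiagram n) (g : G.Arrow)
    (htop : ∀ e : G.Arrow × Bool, e ≠ (g, true) → G.estr e = i → G.hp g < G.epos e)
    (hc : c ∈ J.erase i) (hcS : c ∈ S.erase t) (φ : {x // x ∈ S.erase t} → G.Arrow) :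
    (IsRep G S t A φ ∧ φ ⟨c, hcS⟩ = g) ↔
      IsRep G I t P (fun a => φ (h.arrowEquiv (Sum.inl a))) ∧
      IsRep G J i Q (fun b => φ (h.arrowEquiv (Sum.inr b))) ∧
      φ (h.arrowEquiv (Sum.inr ⟨c, hc⟩)) = g := by
  have hce : h.arrowEquiv (Sum.inr ⟨c, hc⟩) = ⟨c, hcS⟩ := rfl
  rw [hce]
  constructor
  · rintro ⟨⟨hinj, hhs, hts, hrk, htp⟩, hg⟩
    refine ⟨⟨fun a a' he => ?_, fun a => ?_, fun a => hts _, fun a a' he => ?_, fun a a' he => ?_⟩,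
      ⟨fun a a' he => ?_, fun a => ?_, fun a => hts _, fun a a' he => ?_, fun a a' he => ?_⟩, hg⟩
    · exact Sum.inl_injective (h.arrowEquiv.injective (hinj he))
    · rw [hhs, arrowEquiv_inl, h.par_left _ a.2]
    · rw [← h.rk_left _ a.2 _ a'.2 he]
      exact hrk (h.arrowEquiv (Sum.inl a)) (h.arrowEquiv (Sum.inl a'))
        (by simpa [h.par_left _ a.2, h.par_left _ a'.2] using he)
    · exact htp _ _ (by simpa [h.par_left _ a.2] using he)
    · exact Sum.inr_injective (h.arrowEquiv.injective (hinj he))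
    · rw [hhs, arrowEquiv_inr, h.par_right _ a.2]
    · rw [← h.rk_right _ a.2, ← h.rk_right _ a'.2]
      exact hrk (h.arrowEquiv (Sum.inr a)) (h.arrowEquiv (Sum.inr a'))
        (by simpa [h.par_right _ a.2, h.par_right _ a'.2] using he)
    · exact htp _ _ (by simpa [h.par_right _ a.2] using he)
  · rintro ⟨⟨-, hhs₁, hts₁, hrk₁, htp₁⟩, ⟨-, hhs₂, hts₂, hrk₂, htp₂⟩, hg⟩
    have hts : ∀ x, G.ts (φ x) = x.1 := by
      rw [h.arrowEquiv.surjective.forall]; rintro (a | b)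
      exacts [hts₁ a, hts₂ b]
    have hroot : ∀ b : {x // x ∈ J.erase i}, Q.par b.1 = i →
        φ (h.arrowEquiv (Sum.inr b)) = g := by
      intro b hb
      rw [← hg]; exact congrArg φ (Subtype.ext (h.eq_root _ b.2 hb))
    have hne : ∀ a : {x // x ∈ I.erase t}, φ (h.arrowEquiv (Sum.inl a)) ≠ g := by
      intro a ha
      have hac : a.1 = c :=
        (hts₁ a).symm.trans ((congrArg G.ts (ha.trans hg.symm)).trans (hts _))
      exact Finset.disjoint_left.1 h.disjoint a.2 (hac ▸ hc)
    have hcross : ∀ (a : {x // x ∈ I.erase t}) (b : {x // x ∈ J.erase i}),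
        P.par a.1 = Q.par b.1 → A.rk b.1 < A.rk a.1 ∧
          G.hp (φ (h.arrowEquiv (Sum.inr b))) < G.hp (φ (h.arrowEquiv (Sum.inl a))) := by
      intro a b hab
      have hai : P.par a.1 = i :=
        h.eq_of_mem _ (h.par_left_mem _ a.2) (hab ▸ h.par_right_mem _ b.2)
      have hbi : Q.par b.1 = i := hab ▸ hai
      refine ⟨h.eq_root _ b.2 hbi ▸ h.root_lt _ a.2 hai, ?_⟩
      rw [hroot b hbi]
      refine htop (φ (h.arrowEquiv (Sum.inl a)), true) (fun he => hne a (Prod.ext_iff.1 he).1) ?_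
      simpa [GaussDiagram.estr, hai] using hhs₁ a
    refine ⟨⟨fun x y hxy => Subtype.ext ?_, ?_, hts, ?_, ?_⟩, hg⟩
    · rw [← hts, hxy, hts]
    · rw [h.arrowEquiv.surjective.forall]; rintro (a | b)
      · rw [arrowEquiv_inl, h.par_left _ a.2]; exact hhs₁ a
      · rw [arrowEquiv_inr, h.par_right _ b.2]; exact hhs₂ b
    · rw [h.arrowEquiv.surjective.forall₂]
      rintro (a | b) (a' | b') he <;>
        simp only [arrowEquiv_inl, arrowEquiv_inr, h.par_left _ (Subtype.prop _),
          h.par_right _ (Subtype.prop _)] at he ⊢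
      · rw [h.rk_left _ a.2 _ a'.2 he]; exact hrk₁ a a' he
      · obtain ⟨h₁, h₂⟩ := hcross a b' he
        exact iff_of_false h₁.not_gt h₂.not_gt
      · obtain ⟨h₁, h₂⟩ := hcross a' b he.symm
        exact iff_of_true h₁ h₂
      · rw [h.rk_right _ b.2, h.rk_right _ b'.2]; exact hrk₂ b b' he
    · rw [h.arrowEquiv.surjective.forall₂]
      rintro (a | b) (a' | b') he <;>
        simp only [arrowEquiv_inl, arrowEquiv_inr, h.par_left _ (Subtype.prop _),
          h.par_right _ (Subtype.prop _)] at he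
      · exact htp₁ a a' he
      · have hb'i := h.eq_of_mem _ (he ▸ h.par_left_mem _ a.2) (Finset.mem_of_mem_erase b'.2)
        exact absurd hb'i (Finset.mem_erase.1 b'.2).1
      · have ha'i := h.eq_of_mem _ (Finset.mem_of_mem_erase a'.2) (he ▸ h.par_right_mem _ b.2)
        rw [hroot b (he.trans ha'i)]
        refine htop (φ (h.arrowEquiv (Sum.inl a')), false) (by simp) ?_
        simpa [GaussDiagram.estr, ha'i] using hts₁ a'
      · exact htp₂ b b' he

theorem repSign_eq (h : IsTopGluing S I J t i c A P Q) (G : GaussDiagram n)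
    (φ : {x // x ∈ S.erase t} → G.Arrow) :
    repSign G φ = repSign G (fun a => φ (h.arrowEquiv (Sum.inl a))) *
      repSign G (fun b => φ (h.arrowEquiv (Sum.inr b))) := by
  simp only [repSign, finprod_eq_prod_of_fintype]
  rw [← h.arrowEquiv.prod_comp, Fintype.prod_sum_type]

/-- The restricted pairing of a glued diagram factors when the arrow `g` is topmost on the string
of its head. -/
theorem pairTo_eq (h : IsTopGluing S I J t i c A P Q) (G : GaussDiagram n) (g : G.Arrow)
    (htop : ∀ e : G.Arrow × Bool, e ≠ (g, true) → G.estr e = i → G.hp g < G.epos e)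
    (hc : c ∈ J.erase i) (hcS : c ∈ S.erase t) :
    pairTo G S t A ⟨c, hcS⟩ g = pair G I t P * pairTo G J i Q ⟨c, hc⟩ g := by
  classical
  simp only [pairTo, pair, finsum_eq_sum_of_fintype, finsum_eq_if]
  rw [Finset.sum_mul_sum, ← Fintype.sum_prod_type']
  refine Fintype.sum_equiv
    ((h.arrowEquiv.symm.arrowCongr (Equiv.refl G.Arrow)).trans
      (Equiv.sumArrowEquivProdArrow _ _ _)) _ _ fun φ => ?_
  rw [if_congr (h.isRep_iff G g htop hc hcS φ) (h.repSign_eq G φ) rfl]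
  exact (ite_zero_mul_ite_zero _ _ _ _).symm

end IsTopGluing

/-- Stacking `e ≺₂ R` on the `i`-th leaf of `P` is a top gluing. -/
theorem isTopGluing_stack {n p r i s v t : ℕ} {P R : PreTree}
    (hP : P.IsTreeDiagram (Finset.Icc 1 p) v) (hR : R.IsTreeDiagram (Finset.Icc 1 r) s)
    (hv : v ∈ Finset.Icc 1 p) (hs : 1 ≤ s ∧ s ≤ r) (hn : n = p + r) (hi : 1 ≤ i ∧ i ≤ p)
    (ht : t = embP i (r + 1) 1 v) :
    IsTopGluing (Finset.Icc 1 n) (Finset.Icc 1 i ∪ Finset.Icc (i + r + 1) n)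
      (Finset.Icc i (i + r)) t i (i + s)
      (stack i (r + 1) 1 P (stack 2 r s etree R))
      (relabel (Finset.Icc 1 i ∪ Finset.Icc (i + r + 1) n) P)
      (relabel (Finset.Icc i (i + r)) (stack 2 r s etree R)) := by
  set I := Finset.Icc 1 i ∪ Finset.Icc (i + r + 1) n with hI
  set Q := stack 2 r s etree R
  have memI : ∀ x, x ∈ I ↔ (1 ≤ x ∧ x ≤ i) ∨ (i + r + 1 ≤ x ∧ x ≤ n) := by
    intro x; simp [hI]
  have inv_mem : ∀ x ∈ I, invP i (r + 1) 1 x ∈ Finset.Icc 1 p := by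
    intro x hx
    rw [memI] at hx
    simp only [invP, Finset.mem_Icc]; split_ifs <;> omega
  have emb_mem : ∀ k ∈ Finset.Icc 1 p, embP i (r + 1) 1 k ∈ I := by
    intro k hk
    rw [Finset.mem_Icc] at hk
    rw [memI, embP]; split_ifs <;> omega
  have emb_eq : ∀ k, embP i (r + 1) 1 k = i ↔ k = i := by
    intro k; rw [embP]; split_ifs <;> omega
  have outer : ∀ x ∈ I, x ≤ i ∨ i + r + 1 ≤ x := fun x hx => by
    rw [memI] at hx; omega
  have relP : ∀ x ∈ I, (relabel I P).par x = embP i (r + 1) 1 (P.par (invP i (r + 1) 1 x)) := by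
    intro x hx
    simp only [relabel, if_pos hx]
    rw [rankIn_union_Icc hx, enumIn_union_Icc hn (hP.par_mem (inv_mem x hx))]
  have relP_rk : ∀ x ∈ I, (relabel I P).rk x = P.rk (invP i (r + 1) 1 x) := by
    intro x hx
    simp only [relabel, if_pos hx]
    rw [rankIn_union_Icc hx]
  have inv_ne : ∀ x ∈ I.erase t, P.par (invP i (r + 1) 1 x) = i → invP i (r + 1) 1 x ≠ i := by
    intro x hx hpar hinv
    obtain ⟨hxt, hxI⟩ := Finset.mem_erase.1 hx
    have hv' : i = v := hP.eq_trunk_of_par_eq (Finset.mem_Icc.2 hi) (by rwa [hinv] at hpar)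
    apply hxt
    rw [ht, ← hv', (emb_eq i).2 rfl]
    rw [memI] at hxI
    simp only [invP] at hinv; split_ifs at hinv <;> omega
  have memJ : ∀ b, b ∈ (Finset.Icc i (i + r)).erase i → ∃ y, 1 ≤ y ∧ y ≤ r ∧ b = i + y := by
    intro b hb
    simp only [Finset.mem_erase, Finset.mem_Icc] at hb
    exact ⟨b - i, by omega, by omega, by omega⟩
  have parQ : ∀ y, 1 ≤ y → y ≤ r → Q.par (y + 1) ∈ Finset.Icc 1 (r + 1) :=
    fun y hy hyr => stack_etree_par_mem hs.1 hR hy hyr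
  have relQ : ∀ y, 1 ≤ y → y ≤ r →
      (relabel (Finset.Icc i (i + r)) Q).par (i + y) = i + Q.par (y + 1) - 1 := by
    intro y hy hyr
    have := Finset.mem_Icc.1 (parQ y hy hyr)
    simp only [relabel]
    rw [if_pos (by simpa using hyr), rankIn_Icc (by omega), show i + y + 1 - i = y + 1 by omega,
      enumIn_Icc this.1 (by omega)]
  have rk_outer : ∀ x ∈ I.erase t, (stack i (r + 1) 1 P Q).rk x =
      if P.par (invP i (r + 1) 1 x) = i then
        P.rk (invP i (r + 1) 1 x) + qcount (r + 1) 1 Q else P.rk (invP i (r + 1) 1 x) := by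
    intro x hx
    rw [stack_one_rk_of_outer (outer x (Finset.mem_of_mem_erase hx))]
    exact if_congr (and_iff_left_of_imp (inv_ne x hx)) rfl rfl
  have ht_mem : t ∈ I := ht ▸ emb_mem v hv
  refine ⟨?_, ?_, ?_, ?_, ?_, ?_, ?_, ?_, ?_, ?_⟩
  · intro x
    rw [memI] at ht_mem
    simp only [Finset.mem_erase, Finset.mem_Icc, memI]
    omega
  · intro x hx hxJ
    rw [memI] at hx
    rw [Finset.mem_Icc] at hxJ
    omega
  · intro a ha
    have haI := Finset.mem_of_mem_erase ha
    rw [relP a haI]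
    exact emb_mem _ (hP.par_mem (inv_mem a haI))
  · intro b hb
    obtain ⟨y, hy, hyr, rfl⟩ := memJ b hb
    have := Finset.mem_Icc.1 (parQ y hy hyr)
    rw [relQ y hy hyr, Finset.mem_Icc]
    omega
  · intro a ha
    have haI := Finset.mem_of_mem_erase ha
    rw [relP a haI, stack_one_par_of_outer (outer a haI)]
  · intro b hb
    obtain ⟨y, hy, hyr, rfl⟩ := memJ b hb
    rw [relQ y hy hyr, stack_one_par_add hy hyr]
  · intro a ha a' ha' hpar
    have haI := Finset.mem_of_mem_erase ha
    have haI' := Finset.mem_of_mem_erase ha'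
    have hiff : P.par (invP i (r + 1) 1 a) = i ↔ P.par (invP i (r + 1) 1 a') = i := by
      rw [relP a haI, relP a' haI'] at hpar
      rw [← emb_eq, hpar, emb_eq]
    rw [rk_outer a ha, rk_outer a' ha', relP_rk a haI, relP_rk a' haI']
    by_cases h : P.par (invP i (r + 1) 1 a) = i
    · rw [if_pos h, if_pos (hiff.1 h), add_lt_add_iff_right]
    · rw [if_neg h, if_neg (mt hiff.2 h)]
  · intro b hb
    obtain ⟨y, hy, hyr, rfl⟩ := memJ b hb
    rw [stack_one_rk_add hy hyr]
    simp only [relabel]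
    rw [if_pos (by simpa using hyr), rankIn_Icc (by omega), show i + y + 1 - i = y + 1 by omega]
  · intro b hb hbi
    obtain ⟨y, hy, hyr, rfl⟩ := memJ b hb
    rw [relQ y hy hyr] at hbi
    have := Finset.mem_Icc.1 (parQ y hy hyr)
    have hQ1 : Q.par (y + 1) = 1 := by omega
    rw [eq_of_stack_etree_par_eq_one hR hy hyr hQ1]
  · intro a ha hai
    rw [relP a (Finset.mem_of_mem_erase ha), emb_eq] at hai
    rw [stack_one_rk_add hs.1 hs.2, stack_etree_rk_trunk hs.1, rk_outer a ha, if_pos hai]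
    exact Nat.add_pos_right _ (qcount_stack_etree_pos hs.1 hs.2)

/-- **Free-factor factorization of the restricted pairing (top-arrow case).**
Let `g ∼ (i, i+vR)` be an arrow of the Gauss diagram `G` whose head is the
topmost endpoint on the string `i` of `G`.  Let `A ∈ 𝒜(n;t)` contain an arrow
`α ∼ (i, i+vR)` and admit the decomposition `A = P ≺ᵢ Q` with `Q = e ≺₂ R` and
`P ≠ ∅` (i.e. `p ≥ 2`), the elementary tree `e` corresponding to `α`.  With
`I = I(P;A) = [1,i] ∪ [i+r'+1,n]` and `J = I(Q;A) = [i,i+r']` (so that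
`I ∩ J = {i}`), one has
`⟨A,G⟩_{α↦g} = ⟨P,G(I)⟩ · ⟨Q,G(J)⟩_{α↦g}`. -/
theorem free_factor_top (n t i : ℕ) (G : GaussDiagram n) (g : G.Arrow)
    (p r' vP vR : ℕ) (P R : PreTree)
    (hP : P ∈ TreeSetFull p vP) (hR : R ∈ TreeSetFull r' vR)
    (hvP : 1 ≤ vP ∧ vP ≤ p) (hvR : 1 ≤ vR ∧ vR ≤ r')
    (hp2 : 2 ≤ p) (hn : n = p + r') (hi : 1 ≤ i ∧ i ≤ p)
    (A : PreTree) (hAdef : A = stack i (r' + 1) 1 P (stack 2 r' vR etree R))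
    (hA : A ∈ TreeSetFull n t)
    (hgh : G.hs g = i) (hgt : G.ts g = i + vR)
    (htop : ∀ e : G.Arrow × Bool, e ≠ (g, true) → G.estr e = i →
        G.hp g < G.epos e)
    (haA : i + vR ∈ (Finset.Icc 1 n).erase t)
    (haJ : i + vR ∈ (Finset.Icc i (i + r')).erase i) :
    pairTo G (Finset.Icc 1 n) t A ⟨i + vR, haA⟩ g =
      pair G (Finset.Icc 1 i ∪ Finset.Icc (i + r' + 1) n)
          (enumIn (Finset.Icc 1 i ∪ Finset.Icc (i + r' + 1) n) vP)
          (relabel (Finset.Icc 1 i ∪ Finset.Icc (i + r' + 1) n) P) *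
        pairTo G (Finset.Icc i (i + r')) i
          (relabel (Finset.Icc i (i + r')) (stack 2 r' vR etree R))
          ⟨i + vR, haJ⟩ g := by
  have hv : vP ∈ Finset.Icc 1 p := Finset.mem_Icc.2 hvP
  have ht : embP i (r' + 1) 1 vP = t := by
    have hinv : invP i (r' + 1) 1 (embP i (r' + 1) 1 vP) = vP := by
      simp only [invP, embP]; split_ifs <;> omega
    refine hA.1.eq_trunk_of_par_eq ?_ ?_
    · rw [Finset.mem_Icc, embP]; split_ifs <;> omega
    · rw [hAdef, stack_one_par_of_outer, hinv, hP.1.par_trunk]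
      rw [embP]; split_ifs <;> omega
  have hglue := isTopGluing_stack hP.1 hR.1 hv hvR hn hi ht.symm
  rw [← hAdef] at hglue
  rw [enumIn_union_Icc hn hv, ht]
  exact hglue.pairTo_eq G g htop haJ haA
end

section
/- Cancellation over a parallel pair of opposite arrows: let G be a Gauss diagram on n strings containing two arrows g₊ and g₋ of opposite signs, both with heads on string i and tails on string j, such that the two heads are consecutive endpoints on string i and the two tails are consecutive endpoints on string j (in parallel position). Then for every tree diagram A ∈ 𝒜(n;t) and every arrow α ∼ (i,j) of A, one has ⟨A,G⟩_{α↦g₊} + ⟨A,G⟩_{α↦g₋} = 0. -/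
open scoped BigOperators

section ParallelPair

variable {n : ℕ} {G : GaussDiagram n}

lemma GaussDiagram.epos_ne {e e' : G.Arrow × Bool} (hne : e ≠ e')
    (hs : G.estr e = G.estr e') : G.epos e ≠ G.epos e' :=
  fun hp => hne (G.distinct e e' hs hp)

/-- An endpoint other than two consecutive ones lies on the same side of both. -/
lemma Consecutive.lt_iff {e₁ e₂ e : G.Arrow × Bool} (h : Consecutive G e₁ e₂)
    (h₁₂ : G.estr e₁ = G.estr e₂) (h₁ : e ≠ e₁) (h₂ : e ≠ e₂)
    (hs : G.estr e = G.estr e₁) :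
    (G.epos e < G.epos e₁ ↔ G.epos e < G.epos e₂) ∧
      (G.epos e₁ < G.epos e ↔ G.epos e₂ < G.epos e) := by
  have hc := h e h₁ h₂ hs
  have n₁ := GaussDiagram.epos_ne h₁ hs
  have n₂ := GaussDiagram.epos_ne h₂ (hs.trans h₁₂)
  grind

variable {gp gm : G.Arrow}

lemma estr_swap (hhs : G.hs gp = G.hs gm) (hts : G.ts gp = G.ts gm)
    (x : G.Arrow) (b : Bool) :
    G.estr (Equiv.swap gp gm x, b) = G.estr (x, b) := by
  unfold GaussDiagram.estr
  rw [Equiv.swap_apply_def]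
  grind

/-- Swapping a parallel pair preserves the order of two endpoints whose arrows do not
both belong to the pair. -/
lemma epos_swap_lt_iff (hhs : G.hs gp = G.hs gm) (hts : G.ts gp = G.ts gm)
    (hch : Consecutive G (gp, true) (gm, true))
    (hct : Consecutive G (gp, false) (gm, false))
    {x y : G.Arrow} {b c : Bool} (hs : G.estr (x, b) = G.estr (y, c))
    (hxy : (x ≠ gp ∧ x ≠ gm) ∨ (y ≠ gp ∧ y ≠ gm)) :
    G.epos (Equiv.swap gp gm x, b) < G.epos (Equiv.swap gp gm y, c) ↔
      G.epos (x, b) < G.epos (y, c) := by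
  have hstr (d : Bool) : G.estr (gp, d) = G.estr (gm, d) := by
    cases d
    · simpa [GaussDiagram.estr] using hts
    · simpa [GaussDiagram.estr] using hhs
  have hcons (d : Bool) : Consecutive G (gp, d) (gm, d) := by
    cases d <;> assumption
  have key {z : G.Arrow} {d d' : Bool} (hzp : z ≠ gp) (hzm : z ≠ gm)
      (hz : G.estr (z, d) = G.estr (gp, d')) :=
    (hcons d').lt_iff (hstr d') (e := (z, d)) (by simp [hzp]) (by simp [hzm]) hz
  rcases hxy with ⟨h₁, h₂⟩ | ⟨h₁, h₂⟩
  · rw [Equiv.swap_apply_of_ne_of_ne h₁ h₂]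
    by_cases hp : y = gp
    · subst hp
      rw [Equiv.swap_apply_left]
      exact (key h₁ h₂ hs).1.symm
    by_cases hm : y = gm
    · subst hm
      rw [Equiv.swap_apply_right]
      exact (key h₁ h₂ (hs.trans (hstr c).symm)).1
    rw [Equiv.swap_apply_of_ne_of_ne hp hm]
  · rw [Equiv.swap_apply_of_ne_of_ne h₁ h₂]
    by_cases hp : x = gp
    · subst hp
      rw [Equiv.swap_apply_left]
      exact (key h₁ h₂ hs.symm).2.symm
    by_cases hm : x = gm
    · subst hm
      rw [Equiv.swap_apply_right]
      exact (key h₁ h₂ (hs.symm.trans (hstr b).symm)).2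
    rw [Equiv.swap_apply_of_ne_of_ne hp hm]

variable {I : Finset ℕ} {t : ℕ} {A : PreTree} {φ : {x // x ∈ I.erase t} → G.Arrow}

/-- The arrows of a representation have distinct tail strings, so at most one of them
belongs to a pair with common tail string. -/
lemma IsRep.notMem_pair (hts : G.ts gp = G.ts gm) (hφ : IsRep G I t A φ)
    {b c : {x // x ∈ I.erase t}} (hbc : b ≠ c) :
    (φ b ≠ gp ∧ φ b ≠ gm) ∨ (φ c ≠ gp ∧ φ c ≠ gm) := by
  have hb := hφ.2.2.1 b
  have hc := hφ.2.2.1 c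
  have : (b : ℕ) ≠ c := fun h => hbc (Subtype.ext h)
  grind

lemma IsRep.swap_comp (hhs : G.hs gp = G.hs gm) (hts : G.ts gp = G.ts gm)
    (hch : Consecutive G (gp, true) (gm, true))
    (hct : Consecutive G (gp, false) (gm, false))
    (hA : A.IsTreeDiagram I t) (hφ : IsRep G I t A φ) :
    IsRep G I t A (Equiv.swap gp gm ∘ φ) := by
  have hpair {b c : {x // x ∈ I.erase t}} := hφ.notMem_pair hts (b := b) (c := c)
  obtain ⟨hinj, hh, ht, hheads, htails⟩ := hφ
  refine ⟨(Equiv.swap gp gm).injective.comp hinj, fun b => ?_, fun b => ?_,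
    fun b c hbc => ?_, fun b c hbc => ?_⟩
  · exact (estr_swap hhs hts (φ b) true).trans (hh b)
  · exact (estr_swap hhs hts (φ b) false).trans (ht b)
  · by_cases h : b = c
    · simp [h]
    · rw [hheads b c hbc]
      have hs : G.estr (φ b, true) = G.estr (φ c, true) :=
        (hh b).trans (hbc.trans (hh c).symm)
      exact (epos_swap_lt_iff hhs hts hch hct hs (hpair h)).symm
  · have h : b ≠ c := by
      rintro rfl
      exact (hA.1 b b.2).2.1 hbc
    have hs : G.estr (φ b, true) = G.estr (φ c, false) :=
      (hh b).trans (hbc.trans (ht c).symm)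
    exact (epos_swap_lt_iff hhs hts hch hct hs (hpair h)).2 (htails b c hbc)

lemma isRep_swap_comp_iff (hhs : G.hs gp = G.hs gm) (hts : G.ts gp = G.ts gm)
    (hch : Consecutive G (gp, true) (gm, true))
    (hct : Consecutive G (gp, false) (gm, false))
    (hA : A.IsTreeDiagram I t) :
    IsRep G I t A (Equiv.swap gp gm ∘ φ) ↔ IsRep G I t A φ := by
  refine ⟨fun h => ?_, fun h => h.swap_comp hhs hts hch hct hA⟩
  have h' := h.swap_comp hhs hts hch hct hA
  rwa [← Function.comp_assoc, ← Equiv.Perm.coe_mul, Equiv.swap_mul_self,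
    Equiv.Perm.coe_one, Function.id_comp] at h'

lemma IsRep.repSign_swap_comp (hsign : G.sign gp = - G.sign gm)
    (hts : G.ts gp = G.ts gm) (hφ : IsRep G I t A φ)
    {a : {x // x ∈ I.erase t}} (ha : φ a = gp) :
    repSign G (Equiv.swap gp gm ∘ φ) = - repSign G φ := by
  unfold repSign
  rw [finprod_eq_prod_of_fintype, finprod_eq_prod_of_fintype,
    ← Finset.mul_prod_erase _ _ (Finset.mem_univ a),
    ← Finset.mul_prod_erase _ (fun b => G.sign (φ b)) (Finset.mem_univ a), ← neg_mul]
  congr 1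
  · simp [ha, hsign]
  · refine Finset.prod_congr rfl fun b hb => ?_
    rcases hφ.notMem_pair hts (Finset.ne_of_mem_erase hb) with h | h
    · rw [Function.comp_apply, Equiv.swap_apply_of_ne_of_ne h.1 h.2]
    · exact absurd ha h.1

end ParallelPair

/-- **Cancellation over a parallel pair of opposite arrows.**  Let the Gauss
diagram `G` contain two arrows `g₊`, `g₋` of opposite signs, both with heads
on a common string and tails on a common string, the heads consecutive and the
tails consecutive, in parallel position.  Then for every tree diagram
`A ∈ 𝒜(n;t)` containing an arrow `α` with the same head and tail strings (the
arrow tailed at `a`), one has `⟨A,G⟩_{α↦g₊} + ⟨A,G⟩_{α↦g₋} = 0`. -/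
theorem parallel_pair_cancellation (n : ℕ) (G : GaussDiagram n)
    (gp gm : G.Arrow) (hne : gp ≠ gm)
    (hsign : G.sign gp = - G.sign gm)
    (hhs : G.hs gp = G.hs gm) (hts : G.ts gp = G.ts gm)
    (hch : Consecutive G (gp, true) (gm, true))
    (hct : Consecutive G (gp, false) (gm, false))
    (hpar : G.hp gp < G.hp gm ↔ G.tp gp < G.tp gm)
    (t : ℕ) (A : PreTree) (hA : A ∈ TreeSet (Finset.Icc 1 n) t)
    (a : {x // x ∈ (Finset.Icc 1 n).erase t})
    (htail : (a : ℕ) = G.ts gp) (hhead : A.par a.1 = G.hs gp) :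
    pairTo G (Finset.Icc 1 n) t A a gp +
      pairTo G (Finset.Icc 1 n) t A a gm = 0 := by
  suffices h : pairTo G (Finset.Icc 1 n) t A a gm =
      - pairTo G (Finset.Icc 1 n) t A a gp by
    rw [h, add_neg_cancel]
  unfold pairTo
  rw [← finsum_comp_equiv (Equiv.arrowCongr (Equiv.refl _) (Equiv.swap gp gm)),
    ← finsum_neg_distrib]
  refine finsum_congr fun φ => ?_
  change ∑ᶠ _ : IsRep G _ t A (Equiv.swap gp gm ∘ φ) ∧ Equiv.swap gp gm (φ a) = gm,
    repSign G (Equiv.swap gp gm ∘ φ) = _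
  rw [isRep_swap_comp_iff hhs hts hch hct hA.1, Equiv.swap_apply_eq_iff,
    Equiv.swap_apply_right, ← finsum_neg_distrib]
  exact finsum_congr fun h => h.1.repSign_swap_comp hsign hts h.2
end

section
/- Free-factor factorization of the restricted pairing (bottom-arrow case): let G' be a Gauss diagram on n strings and let g' ∼ (t,j), t < j, be an arrow of G' whose head is the bottommost endpoint on string t of G' (no endpoint lies below it on string t). Let A ∈ 𝒜(n;t) contain an arrow α ∼ (t,j) whose head is the bottommost endpoint on the trunk string t of A, and admit the decomposition A = U ≺₁ S with U = e ≺₂ R, where the elementary tree e corresponds to α. Set J = I(U;A) and I = I(S;A). Then ⟨A,G'⟩_{α↦g'} = ⟨S,G'(I)⟩ · ⟨U,G'(J)⟩_{α↦g'}, where G'(I) denotes the subdiagram of G' consisting of the strings indexed by I together with all arrows having both endpoints on those strings. -/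
open scoped BigOperators

/-- Sums of multiplicative weights over functions on `s₁ ∪ s₂` factor when the summation
condition splits into conditions on the two restrictions. -/
theorem finsum_prod_restrict_mul {X : Type*} [Finite X] {s s₁ s₂ : Finset ℕ}
    (hu : s = s₁ ∪ s₂) (hd : Disjoint s₁ s₂) (h₁ : s₁ ⊆ s) (h₂ : s₂ ⊆ s) (f : X → ℤ)
    {p : ({x // x ∈ s} → X) → Prop} {p₁ : ({x // x ∈ s₁} → X) → Prop}
    {p₂ : ({x // x ∈ s₂} → X) → Prop}
    (hp : ∀ φ, p φ ↔ p₁ (fun a => φ ⟨a.1, h₁ a.2⟩) ∧ p₂ (fun a => φ ⟨a.1, h₂ a.2⟩)) :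
    (∑ᶠ (φ : {x // x ∈ s} → X) (_ : p φ), ∏ᶠ a, f (φ a)) =
      (∑ᶠ (φ : {x // x ∈ s₁} → X) (_ : p₁ φ), ∏ᶠ a, f (φ a)) *
        ∑ᶠ (φ : {x // x ∈ s₂} → X) (_ : p₂ φ), ∏ᶠ a, f (φ a) := by
  classical
  subst hu
  have := Fintype.ofFinite X
  simp only [finsum_eq_if, finsum_eq_sum_of_fintype, finprod_eq_prod_of_fintype]
  let u := Equiv.Finset.union s₁ s₂ hd
  let e : ({x // x ∈ s₁ ∪ s₂} → X) ≃ ({x // x ∈ s₁} → X) × ({x // x ∈ s₂} → X) :=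
    (u.symm.arrowCongr (Equiv.refl X)).trans (Equiv.sumArrowEquivProdArrow _ _ _)
  rw [Finset.sum_mul_sum, ← Fintype.sum_prod_type', ← e.sum_comp]
  refine Finset.sum_congr rfl fun φ _ => ?_
  have hprod : ∏ a, f (φ a) = (∏ a, f ((e φ).1 a)) * ∏ a, f ((e φ).2 a) := by
    rw [← u.prod_comp, Fintype.prod_sum_type]
    rfl
  have hpe : p φ ↔ p₁ (e φ).1 ∧ p₂ (e φ).2 := hp φ
  rw [hprod, ite_zero_mul_ite_zero]
  simp only [hpe]

/-- Representations of a tree with trunk `t` whose arrows split into those of `S` (strings `I₁`)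
and those of `U` (strings `J`), the two being glued along the trunk with the only trunk arrow
`a₀` of `U` at the bottom, are pairs of representations of `S` and `U`. -/
theorem isRep_and_iff {n t a₀ : ℕ} {G : GaussDiagram n} {g : G.Arrow} {I I₁ J : Finset ℕ}
    {A S U : PreTree} (h₁ : I₁.erase t ⊆ I.erase t) (h₂ : J.erase t ⊆ I.erase t)
    (hu : I.erase t = I₁.erase t ∪ J.erase t) (hd : Disjoint (I₁.erase t) (J.erase t))
    (ha : a₀ ∈ I.erase t) (haJ : a₀ ∈ J.erase t)
    (hbot : ∀ e : G.Arrow × Bool, e ≠ (g, true) → G.estr e = t → G.epos e < G.hp g)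
    (hgt : G.ts g = a₀)
    (hSpar : ∀ i ∈ I₁.erase t, A.par i = S.par i ∧ S.par i ∈ I₁ ∧ A.rk i = S.rk i)
    (hUpar : ∀ i ∈ J.erase t, A.par i = U.par i ∧ U.par i ∈ J)
    (hUrk : ∀ i ∈ J.erase t, i ≠ a₀ → A.rk i = U.rk i ∧ U.par i ≠ t)
    (ha₀ : U.par a₀ = t)
    (hrk : ∀ i ∈ I₁.erase t, S.par i = t → S.rk i < A.rk a₀)
    (φ : {x // x ∈ I.erase t} → G.Arrow) :
    IsRep G I t A φ ∧ φ ⟨a₀, ha⟩ = g ↔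
      IsRep G I₁ t S (fun a => φ ⟨a.1, h₁ a.2⟩) ∧
        IsRep G J t U (fun a => φ ⟨a.1, h₂ a.2⟩) ∧ φ ⟨a₀, h₂ haJ⟩ = g := by
  constructor
  · rintro ⟨⟨hinj, hhs, hts, hord, htail⟩, hφ⟩
    refine ⟨⟨fun a b hab => Subtype.ext ?_, fun a => ?_, fun a => hts _, fun a b hab => ?_,
      fun a b hab => ?_⟩, ⟨fun a b hab => Subtype.ext ?_, fun a => ?_, fun a => hts _,
      fun a b hab => ?_, fun a b hab => ?_⟩, hφ⟩
    · simpa using hinj hab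
    · rw [hhs, (hSpar _ a.2).1]
    · obtain ⟨pa, -, ra⟩ := hSpar _ a.2
      obtain ⟨pb, -, rb⟩ := hSpar _ b.2
      rw [← ra, ← rb]
      exact hord ⟨a.1, h₁ a.2⟩ ⟨b.1, h₁ b.2⟩ (by simp only [pa, pb, hab])
    · exact htail ⟨a.1, h₁ a.2⟩ ⟨b.1, h₁ b.2⟩ (by simp only [(hSpar _ a.2).1, hab])
    · simpa using hinj hab
    · rw [hhs, (hUpar _ a.2).1]
    · by_cases haa : a.1 = a₀
      · by_cases hba : b.1 = a₀
        · have : a = b := Subtype.ext (haa.trans hba.symm)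
          subst this
          simp
        · exact absurd (by rw [← hab, haa, ha₀]) (hUrk _ b.2 hba).2
      · by_cases hba : b.1 = a₀
        · exact absurd (by rw [hab, hba, ha₀]) (hUrk _ a.2 haa).2
        · rw [← (hUrk _ a.2 haa).1, ← (hUrk _ b.2 hba).1]
          exact hord ⟨a.1, h₂ a.2⟩ ⟨b.1, h₂ b.2⟩
            (by simp only [(hUpar _ a.2).1, (hUpar _ b.2).1, hab])
    · exact htail ⟨a.1, h₂ a.2⟩ ⟨b.1, h₂ b.2⟩ (by simp only [(hUpar _ a.2).1, hab])
  · rintro ⟨⟨-, hhs₁, hts₁, hord₁, htail₁⟩, ⟨-, hhs₂, hts₂, hord₂, htail₂⟩, hφ⟩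
    have hsplit : ∀ a ∈ I.erase t, a ∈ I₁.erase t ∨ a ∈ J.erase t := fun a h => by
      rwa [hu, Finset.mem_union] at h
    have hts : ∀ a, G.ts (φ a) = a.1 := fun a => by
      rcases hsplit _ a.2 with h | h
      · exact hts₁ ⟨a.1, h⟩
      · exact hts₂ ⟨a.1, h⟩
    have hhs : ∀ a, G.hs (φ a) = A.par a.1 := fun a => by
      rcases hsplit _ a.2 with h | h
      · exact (hhs₁ ⟨a.1, h⟩).trans (hSpar _ h).1.symm
      · exact (hhs₂ ⟨a.1, h⟩).trans (hUpar _ h).1.symm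
    have hcross : ∀ x ∈ I₁, x ∈ J → x = t := fun x hx hx' => by
      by_contra hne
      exact Finset.disjoint_left.1 hd (Finset.mem_erase.2 ⟨hne, hx⟩)
        (Finset.mem_erase.2 ⟨hne, hx'⟩)
    -- an arrow of `S` and an arrow of `U` can only share the head string `t`
    have hmix : ∀ a b : {x // x ∈ I.erase t}, a.1 ∈ I₁.erase t → b.1 ∈ J.erase t →
        A.par a.1 = A.par b.1 → A.rk a.1 < A.rk b.1 ∧ G.hp (φ a) < G.hp (φ b) := by
      intro a b h h' hab
      obtain ⟨pa, ma, ra⟩ := hSpar _ h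
      obtain ⟨pb, mb⟩ := hUpar _ h'
      have hSU : S.par a.1 = U.par b.1 := by rw [← pa, ← pb, hab]
      have hSt : S.par a.1 = t := hcross _ ma (hSU ▸ mb)
      have hb : b.1 = a₀ := by
        by_contra hne
        exact (hUrk _ h' hne).2 (hSU ▸ hSt)
      have hbg : φ b = g := by
        rw [← hφ]
        exact congrArg φ (Subtype.ext hb)
      refine ⟨by rw [ra, hb]; exact hrk _ h hSt, ?_⟩
      rw [hbg]
      refine hbot (φ a, true) (fun heq => ?_) ?_
      · have hag : φ a = g := congrArg Prod.fst heq
        have haa₀ : a.1 = a₀ := by rw [← hts a, hag, hgt]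
        exact Finset.disjoint_left.1 hd h (haa₀ ▸ haJ)
      · simp only [GaussDiagram.estr, if_true]
        rw [hhs a, pa, hSt]
    refine ⟨⟨fun a b hab => Subtype.ext ?_, hhs, hts, fun a b hab => ?_, fun a b hab => ?_⟩, hφ⟩
    · rw [← hts a, ← hts b, hab]
    · rcases hsplit _ a.2 with h | h <;> rcases hsplit _ b.2 with h' | h'
      · rw [(hSpar _ h).2.2, (hSpar _ h').2.2]
        exact hord₁ ⟨a.1, h⟩ ⟨b.1, h'⟩ (by simp only [← (hSpar _ h).1, ← (hSpar _ h').1, hab])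
      · have := hmix a b h h' hab
        exact iff_of_true this.1 this.2
      · have := hmix b a h' h hab.symm
        exact iff_of_false this.1.not_gt this.2.not_gt
      · by_cases hab' : a = b
        · subst hab'
          simp
        have hUab : U.par a.1 = U.par b.1 := by rw [← (hUpar _ h).1, ← (hUpar _ h').1, hab]
        have hane : a.1 ≠ a₀ := fun haa => by
          have hbne : b.1 ≠ a₀ := fun hba => hab' (Subtype.ext (haa.trans hba.symm))
          exact (hUrk _ h' hbne).2 (by rw [← hUab, haa, ha₀])
        have hbne : b.1 ≠ a₀ := fun hba => (hUrk _ h hane).2 (by rw [hUab, hba, ha₀])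
        rw [(hUrk _ h hane).1, (hUrk _ h' hbne).1]
        exact hord₂ ⟨a.1, h⟩ ⟨b.1, h'⟩ hUab
    · have hbt : b.1 ≠ t := (Finset.mem_erase.1 b.2).1
      rcases hsplit _ a.2 with h | h <;> rcases hsplit _ b.2 with h' | h'
      · exact htail₁ ⟨a.1, h⟩ ⟨b.1, h'⟩ (by simp only [← (hSpar _ h).1, hab])
      · refine absurd (hcross b.1 ?_ (Finset.mem_of_mem_erase h')) hbt
        rw [← hab, (hSpar _ h).1]
        exact (hSpar _ h).2.1
      · refine absurd (hcross b.1 (Finset.mem_of_mem_erase h') ?_) hbt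
        rw [← hab, (hUpar _ h).1]
        exact (hUpar _ h).2
      · exact htail₂ ⟨a.1, h⟩ ⟨b.1, h'⟩ (by simp only [← (hUpar _ h).1, hab])

section Stack

variable {s r v w i : ℕ} {P S R : PreTree}

theorem stack_par_of_mem (h₁ : 1 ≤ i) (h₂ : i ≤ s) (h : i ≠ v) :
    (stack 1 s v P S).par i = S.par i := by
  have h' : 1 ≤ i ∧ i ≤ 1 + s - 1 ∧ i ≠ 1 + v - 1 := by omega
  simp only [stack, if_pos h', Nat.sub_add_cancel h₁]
  omega

theorem stack_rk_of_mem (h₁ : 1 ≤ i) (h₂ : i ≤ s) (h : i ≠ v) :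
    (stack 1 s v P S).rk i = S.rk i := by
  have h' : 1 ≤ i ∧ i ≤ 1 + s - 1 ∧ i ≠ 1 + v - 1 := by omega
  simp only [stack, if_pos h', Nat.sub_add_cancel h₁]

theorem invP_one_of_lt (hi : s < i) (hvs : v ≤ s) : invP 1 s v i = i - (s - 1) := by
  have h₁ : ¬ i < 1 := by omega
  have h₂ : ¬ i = 1 + v - 1 := by omega
  simp only [invP, if_neg h₁, if_neg h₂]

theorem stack_par_of_lt (hi : s < i) (hvs : v ≤ s) :
    (stack 1 s v P S).par i = embP 1 s v (P.par (i - (s - 1))) := by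
  have h' : ¬ (1 ≤ i ∧ i ≤ 1 + s - 1 ∧ i ≠ 1 + v - 1) := by omega
  simp only [stack, if_neg h', invP_one_of_lt hi hvs]

theorem stack_rk_of_lt (hi : s < i) (hvs : v ≤ s) (hs : 1 ≤ s) :
    (stack 1 s v P S).rk i =
      if P.par (i - (s - 1)) = 1 then P.rk (i - (s - 1)) + qcount s v S
      else P.rk (i - (s - 1)) := by
  have h' : ¬ (1 ≤ i ∧ i ≤ 1 + s - 1 ∧ i ≠ 1 + v - 1) := by omega
  have h'' : i - (s - 1) ≠ 1 := by omega
  simp only [stack, if_neg h', invP_one_of_lt hi hvs, h'', ne_eq, not_false_eq_true, and_true]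

theorem stack_etree_par (h₁ : 2 ≤ i) (h₂ : i ≤ r + 1) (h : i ≠ w + 1) :
    (stack 2 r w etree R).par i = R.par (i - 1) + 1 := by
  have h' : 2 ≤ i ∧ i ≤ 2 + r - 1 ∧ i ≠ 2 + w - 1 := by omega
  have hi : i - 2 + 1 = i - 1 := by omega
  simp only [stack, if_pos h', hi]
  omega

theorem stack_etree_par_root (hw : 1 ≤ w) : (stack 2 r w etree R).par (w + 1) = 1 := by
  have h' : ¬ (2 ≤ w + 1 ∧ w + 1 ≤ 2 + r - 1 ∧ w + 1 ≠ 2 + w - 1) := by omega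
  have hinv : invP 2 r w (w + 1) = 2 := by
    have h₁ : ¬ w + 1 < 2 := by omega
    have h₂ : w + 1 = 2 + w - 1 := by omega
    simp only [invP, if_neg h₁, if_pos h₂]
  simp only [stack, if_neg h', hinv]
  simp [etree, embP]

end Stack

theorem sort_insert_Icc {v s n : ℕ} (hv : v ≤ s) :
    (insert v (Finset.Icc (s + 1) n)).sort (· ≤ ·) = v :: List.range' (s + 1) (n - s) := by
  have hmem : ∀ x ∈ List.range' (s + 1) (n - s), v < x := fun x hx => by
    rw [List.mem_range'_1] at hx
    omega
  have hset : insert v (Finset.Icc (s + 1) n) =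
      (v :: List.range' (s + 1) (n - s)).toFinset := by
    ext x
    simp only [Finset.mem_insert, Finset.mem_Icc, List.mem_toFinset, List.mem_cons,
      List.mem_range'_1]
    omega
  rw [hset, List.toFinset_sort]
  · exact List.pairwise_cons.2 ⟨fun x hx => (hmem x hx).le,
      (List.pairwise_lt_range' (step := 1)).imp fun h => h.le⟩
  · exact List.nodup_cons.2 ⟨fun h => (hmem v h).false, List.nodup_range'⟩

theorem enumIn_insert_one {v s n : ℕ} (hv : v ≤ s) :
    enumIn (insert v (Finset.Icc (s + 1) n)) 1 = v := by
  simp [enumIn, sort_insert_Icc hv]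

theorem enumIn_insert_add_one {v s n k : ℕ} (hv : v ≤ s) (hk : 1 ≤ k) (hkn : k + s ≤ n) :
    enumIn (insert v (Finset.Icc (s + 1) n)) (k + 1) = k + s := by
  obtain ⟨k, rfl⟩ := Nat.exists_eq_add_of_le' hk
  have hlt : k < n - s := by omega
  simp [enumIn, sort_insert_Icc hv, List.getD_eq_getElem?_getD, hlt]
  omega

theorem rankIn_insert {v s n x : ℕ} (hv : v ≤ s) (hx : s < x) (hxn : x ≤ n) :
    rankIn (insert v (Finset.Icc (s + 1) n)) x = x - s + 1 := by
  have hset : (insert v (Finset.Icc (s + 1) n)).filter (fun y => y ≤ x) =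
      insert v (Finset.Icc (s + 1) x) := by
    ext y
    simp only [Finset.mem_filter, Finset.mem_insert, Finset.mem_Icc]
    omega
  have hnot : v ∉ Finset.Icc (s + 1) x := by
    simp only [Finset.mem_Icc]
    omega
  rw [rankIn, hset, Finset.card_insert_of_notMem hnot, Nat.card_Icc]
  omega

/-- **Free-factor factorization of the restricted pairing (bottom-arrow
case).**  Let `g' ∼ (t, vR+s)`, `t < vR+s`, be an arrow of the Gauss diagram
`G'` whose head is the bottommost endpoint on the string `t = vS`.  Let
`A ∈ 𝒜(n;t)` contain an arrow `α ∼ (t, vR+s)` whose head is the bottommost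
arrowhead on the trunk string `t` of `A` and admit the decomposition
`A = U ≺₁ S` with `U = e ≺₂ R`, the elementary tree `e` corresponding to `α`.
With `J = I(U;A) = {t} ∪ [s+1,n]` and `I = I(S;A) = [1,s]`, one has
`⟨A,G'⟩_{α↦g'} = ⟨S,G'(I)⟩ · ⟨U,G'(J)⟩_{α↦g'}`. -/
theorem free_factor_bottom (n s r vS vR : ℕ) (G' : GaussDiagram n)
    (g' : G'.Arrow) (S R : PreTree)
    (hS : S ∈ TreeSetFull s vS) (hR : R ∈ TreeSetFull r vR)
    (hvS : 1 ≤ vS ∧ vS ≤ s) (hvR : 1 ≤ vR ∧ vR ≤ r)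
    (hn : n = r + s)
    (A : PreTree) (hAdef : A = stack 1 s vS (stack 2 r vR etree R) S)
    (hA : A ∈ TreeSetFull n vS)
    (hgh : G'.hs g' = vS) (hgt : G'.ts g' = vR + s) (hij : vS < vR + s)
    (hbot : ∀ e : G'.Arrow × Bool, e ≠ (g', true) → G'.estr e = vS →
        G'.epos e < G'.hp g')
    (hbotA : ∀ b ∈ (Finset.Icc 1 n).erase vS,
        A.par b = vS → A.rk b ≤ A.rk (vR + s))
    (haA : vR + s ∈ (Finset.Icc 1 n).erase vS)
    (haJ : vR + s ∈ (insert vS (Finset.Icc (s + 1) n)).erase vS) :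
    pairTo G' (Finset.Icc 1 n) vS A ⟨vR + s, haA⟩ g' =
      pair G' (Finset.Icc 1 s) vS S *
        pairTo G' (insert vS (Finset.Icc (s + 1) n)) vS
          (relabel (insert vS (Finset.Icc (s + 1) n)) (stack 2 r vR etree R))
          ⟨vR + s, haJ⟩ g' := by
  obtain ⟨hv₁, hvs⟩ := hvS
  obtain ⟨hw₁, hwr⟩ := hvR
  subst hn hAdef
  set U := stack 2 r vR etree R
  set J := insert vS (Finset.Icc (s + 1) (r + s))
  have hmemS : ∀ i, i ∈ (Finset.Icc 1 s).erase vS ↔ i ≠ vS ∧ 1 ≤ i ∧ i ≤ s := fun i => by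
    rw [Finset.mem_erase, Finset.mem_Icc]
  have hmemA : ∀ i, i ∈ (Finset.Icc 1 (r + s)).erase vS ↔ i ≠ vS ∧ 1 ≤ i ∧ i ≤ r + s :=
    fun i => by rw [Finset.mem_erase, Finset.mem_Icc]
  have hmemJ : ∀ i, i ∈ J.erase vS ↔ s < i ∧ i ≤ r + s := fun i => by
    simp only [J, Finset.mem_erase, Finset.mem_insert, Finset.mem_Icc]
    omega
  have h₁ : (Finset.Icc 1 s).erase vS ⊆ (Finset.Icc 1 (r + s)).erase vS := fun i hi => by
    rw [hmemS] at hi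
    rw [hmemA]
    omega
  have h₂ : J.erase vS ⊆ (Finset.Icc 1 (r + s)).erase vS := fun i hi => by
    rw [hmemJ] at hi
    rw [hmemA]
    omega
  have hu : (Finset.Icc 1 (r + s)).erase vS = (Finset.Icc 1 s).erase vS ∪ J.erase vS := by
    ext i
    rw [Finset.mem_union, hmemA, hmemS, hmemJ]
    omega
  have hd : Disjoint ((Finset.Icc 1 s).erase vS) (J.erase vS) := by
    rw [Finset.disjoint_left]
    intro i hi hi'
    rw [hmemS] at hi
    rw [hmemJ] at hi'
    omega
  have hUroot : U.par (vR + 1) = 1 := stack_etree_par_root hw₁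
  -- the arrows of `U` other than the one coming from `e`
  have hUpar : ∀ i, s < i → i ≤ r + s → i ≠ vR + s →
      U.par (i - s + 1) = R.par (i - s) + 1 ∧ 1 ≤ R.par (i - s) ∧ R.par (i - s) ≤ r := by
    intro i hi hin hne
    have hR' := (hR.1.1 (i - s) (Finset.mem_erase.2
      ⟨by omega, Finset.mem_Icc.2 ⟨by omega, by omega⟩⟩)).1
    exact ⟨stack_etree_par (by omega) (by omega) (by omega), Finset.mem_Icc.1 hR'⟩
  have hsub : ∀ i, s < i → i - (s - 1) = i - s + 1 := fun i hi => by omega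
  have hsubw : vR + s - (s - 1) = vR + 1 := by omega
  have hrelpar : ∀ i, s < i → i ≤ r + s →
      (relabel J U).par i = enumIn J (U.par (i - s + 1)) := fun i hi hin => by
    have hiJ : i ∈ J := Finset.mem_of_mem_erase ((hmemJ i).2 ⟨hi, hin⟩)
    simp only [relabel, if_pos hiJ, J, rankIn_insert hvs hi hin]
  have hrelrk : ∀ i, s < i → i ≤ r + s →
      (relabel J U).rk i = U.rk (i - s + 1) := fun i hi hin => by
    have hiJ : i ∈ J := Finset.mem_of_mem_erase ((hmemJ i).2 ⟨hi, hin⟩)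
    simp only [relabel, if_pos hiJ, J, rankIn_insert hvs hi hin]
  have hrelroot : (relabel J U).par (vR + s) = vS := by
    rw [hrelpar _ (by omega) (by omega), Nat.add_sub_cancel, hUroot]
    exact enumIn_insert_one hvs
  have hrel : ∀ i, s < i → i ≤ r + s → i ≠ vR + s →
      (relabel J U).par i = R.par (i - s) + s := fun i hi hin hne => by
    obtain ⟨hU, hR₁, hR₂⟩ := hUpar i hi hin hne
    rw [hrelpar i hi hin, hU]
    exact enumIn_insert_add_one hvs hR₁ (by omega)
  refine finsum_prod_restrict_mul hu hd h₁ h₂ G'.sign fun φ =>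
    isRep_and_iff h₁ h₂ hu hd haA haJ hbot hgt ?_ ?_ ?_ hrelroot ?_ φ
  · intro i hi
    have hpar := (hS.1.1 i hi).1
    rw [hmemS] at hi
    exact ⟨stack_par_of_mem hi.2.1 hi.2.2 hi.1, hpar, stack_rk_of_mem hi.2.1 hi.2.2 hi.1⟩
  · intro i hi
    rw [hmemJ] at hi
    rw [stack_par_of_lt hi.1 hvs]
    by_cases hne : i = vR + s
    · subst hne
      rw [hrelroot, hsubw, hUroot]
      exact ⟨by simp [embP], Finset.mem_insert_self _ _⟩
    · obtain ⟨hU, hR₁, hR₂⟩ := hUpar i hi.1 hi.2 hne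
      rw [hrel i hi.1 hi.2 hne, hsub i hi.1, hU]
      refine ⟨?_, Finset.mem_of_mem_erase ((hmemJ _).2 ⟨by omega, by omega⟩)⟩
      simp only [embP]
      split_ifs <;> omega
  · intro i hi hne
    rw [hmemJ] at hi
    obtain ⟨hU, hR₁, hR₂⟩ := hUpar i hi.1 hi.2 hne
    have hU₁ : U.par (i - s + 1) ≠ 1 := by omega
    rw [stack_rk_of_lt hi.1 hvs (by omega), hsub i hi.1, if_neg hU₁, hrelrk i hi.1 hi.2,
      hrel i hi.1 hi.2 hne]
    exact ⟨rfl, by omega⟩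
  · intro i hi hSt
    have hrk := (hS.1.1 i hi).2.2
    rw [hSt] at hrk
    rw [stack_rk_of_lt (by omega) hvs (by omega), hsubw, if_pos hUroot]
    exact hrk.trans_le (Nat.le_add_left _ _)
end
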